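/- If H is a graph and v is a vertex of H of degree at most 3 such that H − v is planar and triangle-free, then H is 3-colorable. -/

import Mathlib

universe u
variable {V : Type u}



/-- A topological embedding (drawing) of a simple graph in a topological space `X`:
vertices map to distinct points, edges map to arcs meeting only at common endpoints. -/
structure GraphEmbeddingIn (X : Type*) [TopologicalSpace X] (G : SimpleGraph V) where
  vertexPos : V → X
  vertexInj : Function.Injective vertexPos
  edgeArc : ∀ u v : V, G.Adj u v → ℝ → X
  arc_cont : ∀ u v h, ContinuousOn (edgeArc u v h) (Set.Icc 0 1)
  arc_injOn : ∀ u v h, Set.InjOn (edgeArc u v h) (Set.Icc 0 1)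
  arc_start : ∀ u v h, edgeArc u v h 0 = vertexPos u
  arc_end : ∀ u v h, edgeArc u v h 1 = vertexPos v
  arc_avoid : ∀ u v h (w : V), vertexPos w ∉ edgeArc u v h '' Set.Ioo 0 1
  arc_disjoint : ∀ u v h u' v' h', s(u, v) ≠ s(u', v') →
    edgeArc u v h '' Set.Ioo 0 1 ∩ edgeArc u' v' h' '' Set.Icc 0 1 = ∅

/-- A graph is planar if it has a drawing in the plane. -/
def SimpleGraph.IsPlanar (G : SimpleGraph V) : Prop :=
  Nonempty (GraphEmbeddingIn (ℝ × ℝ) G)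

universe w

namespace SimpleGraph

section Potential

open scoped Classical

/-- The number of ordered pairs in `A × B` that are edges. -/
noncomputable def crossCount (G : SimpleGraph V) (A B : Finset V) : ℤ :=
  ∑ u ∈ A, ∑ w ∈ B, if G.Adj u w then 1 else 0

/-- Twice the Kostochka–Yancey potential `5 |S| - 3 e(G[S])`. -/
noncomputable def potential (G : SimpleGraph V) (S : Finset V) : ℤ :=
  10 * S.card - 3 * G.crossCount S S

/-- `G[S]` has a proper colouring with three colours. -/
def ColorableOn (G : SimpleGraph V) (S : Finset V) : Prop :=
  ∃ c : V → Fin 3, ∀ u ∈ S, ∀ w ∈ S, G.Adj u w → c u ≠ c w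

lemma crossCount_comm (G : SimpleGraph V) (A B : Finset V) :
    G.crossCount A B = G.crossCount B A := by
  unfold crossCount
  rw [Finset.sum_comm]
  simp only [G.adj_comm]

lemma crossCount_nonneg (G : SimpleGraph V) (A B : Finset V) : 0 ≤ G.crossCount A B :=
  Finset.sum_nonneg fun _ _ => Finset.sum_nonneg fun _ _ => by split_ifs <;> simp

lemma crossCount_union_left (G : SimpleGraph V) {A B : Finset V} (C : Finset V)
    (h : Disjoint A B) : G.crossCount (A ∪ B) C = G.crossCount A C + G.crossCount B C :=
  Finset.sum_union h

lemma crossCount_union_right (G : SimpleGraph V) {A B : Finset V} (C : Finset V)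
    (h : Disjoint A B) : G.crossCount C (A ∪ B) = G.crossCount C A + G.crossCount C B := by
  rw [crossCount_comm, crossCount_union_left G C h, crossCount_comm G A, crossCount_comm G B]

lemma crossCount_union_self (G : SimpleGraph V) {A B : Finset V} (h : Disjoint A B) :
    G.crossCount (A ∪ B) (A ∪ B) =
      G.crossCount A A + G.crossCount B B + 2 * G.crossCount A B := by
  rw [crossCount_union_left _ _ h, crossCount_union_right _ _ h, crossCount_union_right _ _ h,
    crossCount_comm G B A]
  ring

lemma crossCount_singleton (G : SimpleGraph V) (x : V) (B : Finset V) :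
    G.crossCount {x} B = (B.filter (G.Adj x)).card := by
  simp [crossCount, Finset.sum_boole]

lemma crossCount_eq_sum (G : SimpleGraph V) (A B : Finset V) :
    G.crossCount A B = ∑ x ∈ A, ((B.filter (G.Adj x)).card : ℤ) := by
  simp [crossCount, Finset.sum_boole]

lemma crossCount_singleton_self (G : SimpleGraph V) (x : V) : G.crossCount {x} {x} = 0 := by
  simp [crossCount]

lemma crossCount_pos (G : SimpleGraph V) {A B : Finset V} {u w : V} (hu : u ∈ A) (hw : w ∈ B)
    (h : G.Adj u w) : 1 ≤ G.crossCount A B := by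
  unfold crossCount
  calc (1 : ℤ) = if G.Adj u w then 1 else 0 := by simp [h]
    _ ≤ ∑ w ∈ B, if G.Adj u w then 1 else 0 :=
      Finset.single_le_sum (f := fun w => if G.Adj u w then (1 : ℤ) else 0)
        (fun _ _ => by split_ifs <;> simp) hw
    _ ≤ _ := Finset.single_le_sum
        (f := fun u => ∑ w ∈ B, if G.Adj u w then (1 : ℤ) else 0)
        (fun _ _ => Finset.sum_nonneg fun _ _ => by split_ifs <;> simp) hu

lemma crossCount_mono_right (G : SimpleGraph V) (A : Finset V) {B C : Finset V} (h : B ⊆ C) :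
    G.crossCount A B ≤ G.crossCount A C :=
  Finset.sum_le_sum fun _ _ => Finset.sum_le_sum_of_subset_of_nonneg h
    fun _ _ _ => by split_ifs <;> simp

lemma crossCount_insert_self (G : SimpleGraph V) {x : V} {S : Finset V} (h : x ∉ S) :
    G.crossCount (insert x S) (insert x S) = G.crossCount S S + 2 * G.crossCount {x} S := by
  rw [Finset.insert_eq, crossCount_union_self _ (by simpa using h), crossCount_singleton_self]
  ring

lemma even_crossCount_self (G : SimpleGraph V) (S : Finset V) : Even (G.crossCount S S) := by
  induction S using Finset.induction_on with
  | empty => simp [crossCount]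
  | insert x S hx ih =>
    rw [crossCount_insert_self G hx]
    exact ih.add (even_two_mul _)

lemma even_potential (G : SimpleGraph V) (S : Finset V) : Even (G.potential S) := by
  obtain ⟨k, hk⟩ := G.even_crossCount_self S
  exact ⟨5 * S.card - 3 * k, by rw [potential, hk]; ring⟩

lemma potential_union (G : SimpleGraph V) {A B : Finset V} (h : Disjoint A B) :
    G.potential (A ∪ B) = G.potential A + G.potential B - 6 * G.crossCount A B := by
  rw [potential, potential, potential, crossCount_union_self _ h, Finset.card_union_of_disjoint h]
  push_cast
  ring

lemma potential_insert (G : SimpleGraph V) {x : V} {S : Finset V} (h : x ∉ S) :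
    G.potential (insert x S) = G.potential S + 10 - 6 * G.crossCount {x} S := by
  rw [potential, potential, crossCount_insert_self _ h, Finset.card_insert_of_notMem h]
  push_cast
  ring

lemma crossCount_self_le (G : SimpleGraph V) (S : Finset V) :
    G.crossCount S S ≤ S.card * (S.card - 1) := by
  induction S using Finset.induction_on with
  | empty => simp [crossCount]
  | insert x S hx ih =>
    rw [crossCount_insert_self G hx, crossCount_singleton, Finset.card_insert_of_notMem hx]
    have : (S.filter (G.Adj x)).card ≤ S.card := Finset.card_filter_le _ _
    push_cast
    nlinarith

lemma ColorableOn.of_card_le {G : SimpleGraph V} {S : Finset V} (h : S.card ≤ 3) :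
    G.ColorableOn S := by
  obtain ⟨f⟩ : Nonempty (S ↪ Fin 3) := Function.Embedding.nonempty_of_card_le (by simpa using h)
  refine ⟨fun x => if hx : x ∈ S then f ⟨x, hx⟩ else 0, fun u hu w hw huw => ?_⟩
  simp only [hu, hw, dif_pos]
  intro h
  exact huw.ne (by simpa using f.injective h)

lemma four_le_card_of_not_colorableOn {G : SimpleGraph V} {S : Finset V}
    (h : ¬ G.ColorableOn S) : 4 ≤ S.card := by
  by_contra hlt
  exact h (.of_card_le (by omega))

/-- Adding one edge lowers the potential by at most `6`. -/
lemma potential_le_potential_sup_edge (G : SimpleGraph V) {a b : V} (S : Finset V) :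
    G.potential S ≤ (G ⊔ edge a b).potential S + 6 := by
  have key : (G ⊔ edge a b).crossCount S S ≤ G.crossCount S S + 2 := by
    have h1 : ∀ p q : V, ∑ u ∈ S, ∑ w ∈ S,
        (if u = p then if w = q then (1 : ℤ) else 0 else 0) ≤ 1 := by
      intro p q
      simp only [← ite_and]
      rw [← Finset.sum_product' (f := fun u w => if u = p ∧ w = q then (1 : ℤ) else 0),
        Finset.sum_boole]
      have : ((S ×ˢ S).filter fun x => x.1 = p ∧ x.2 = q).card ≤ 1 := by
        rw [Finset.card_le_one]
        rintro ⟨_, _⟩ hx ⟨_, _⟩ hy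
        simp only [Finset.mem_filter] at hx hy
        simp [hx.2, hy.2]
      exact_mod_cast this
    have h2 : (G ⊔ edge a b).crossCount S S ≤ ∑ u ∈ S, ∑ w ∈ S,
        ((if G.Adj u w then (1 : ℤ) else 0) +
          ((if u = a then if w = b then 1 else 0 else 0) +
            (if u = b then if w = a then 1 else 0 else 0))) := by
      refine Finset.sum_le_sum fun u _ => Finset.sum_le_sum fun w _ => ?_
      simp only [sup_adj, edge_adj]
      split_ifs <;> simp_all
    simp only [Finset.sum_add_distrib] at h2
    have := h1 a b
    have := h1 b a
    unfold crossCount at h2 ⊢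
    linarith
  unfold potential
  linarith

end Potential

end SimpleGraph

namespace SimpleGraph

section KostochkaYancey

open scoped Classical

/-- The graph obtained from `G` by replacing the vertices of `R`, coloured by `φ`, with a triangle
whose vertices stand for the colour classes. -/
def collapse (G : SimpleGraph V) (R : Finset V) (φ : V → Fin 3) : SimpleGraph (V ⊕ Fin 3) where
  Adj
    | .inl u, .inl w => G.Adj u w
    | .inl u, .inr i => ∃ y ∈ R, φ y = i ∧ G.Adj u y
    | .inr i, .inl u => ∃ y ∈ R, φ y = i ∧ G.Adj u y
    | .inr i, .inr j => i ≠ j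
  symm := ⟨by 
    rintro (u | i) (w | j) h
    exacts [G.adj_symm h, h, h, (show i ≠ j from h).symm]⟩
  loopless := ⟨by rintro (u | i) h; exacts [G.loopless.irrefl u h, h rfl]⟩

lemma not_colorableOn_collapse {G : SimpleGraph V} {A R : Finset V} {φ : V → Fin 3}
    (hA : ¬ G.ColorableOn A) (hφ : ∀ u ∈ R, ∀ w ∈ R, G.Adj u w → φ u ≠ φ w) :
    ¬ (G.collapse R φ).ColorableOn ((A \ R).disjSum Finset.univ) := by
  rintro ⟨c, hc⟩
  refine hA ⟨fun x => if x ∈ R then c (.inr (φ x)) else c (.inl x), fun u hu w hw huw => ?_⟩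
  by_cases huR : u ∈ R <;> by_cases hwR : w ∈ R <;> simp only [huR, hwR, if_true, if_false]
  · exact hc _ (by simp) _ (by simp) (hφ u huR w hwR huw)
  · exact hc _ (by simp) _ (by simp [hw, hwR]) ⟨u, huR, rfl, huw.symm⟩
  · exact hc _ (by simp [hu, huR]) _ (by simp) ⟨w, hwR, rfl, huw⟩
  · exact hc _ (by simp [hu, huR]) _ (by simp [hw, hwR]) huw

lemma potential_disjSum_collapse (G : SimpleGraph V) (R U : Finset V) (φ : V → Fin 3)
    (X : Finset (Fin 3)) :
    G.potential U + (10 * X.card - 3 * (X.card * (X.card - 1))) -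
        6 * G.crossCount U (R.filter fun y => φ y ∈ X) ≤
      (G.collapse R φ).potential (U.disjSum X) := by
  have h1 : ∀ u, (∑ i ∈ X, if (G.collapse R φ).Adj (.inl u) (.inr i) then (1 : ℤ) else 0) ≤
      ∑ y ∈ R.filter (fun y => φ y ∈ X), if G.Adj u y then 1 else 0 := by
    intro u
    rw [Finset.sum_boole, Finset.sum_boole]
    norm_cast
    refine (Finset.card_le_card ?_).trans
      (Finset.card_image_le (f := φ) (s := (R.filter fun y => φ y ∈ X).filter (G.Adj u)))
    intro i hi
    obtain ⟨hiX, y, hy, rfl, huy⟩ := Finset.mem_filter.1 hi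
    exact Finset.mem_image.2 ⟨y, by simp [hy, hiX, huy], rfl⟩
  have h2 : (∑ u ∈ U, ∑ i ∈ X,
      if (G.collapse R φ).Adj (.inl u) (.inr i) then (1 : ℤ) else 0) ≤
      G.crossCount U (R.filter fun y => φ y ∈ X) := Finset.sum_le_sum fun u _ => h1 u
  have h3 : (∑ i ∈ X, ∑ u ∈ U,
      if (G.collapse R φ).Adj (.inr i) (.inl u) then (1 : ℤ) else 0) ≤
      G.crossCount U (R.filter fun y => φ y ∈ X) := by
    rw [Finset.sum_comm]
    exact Finset.sum_le_sum fun u _ => h1 u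
  have h4 : (∑ i ∈ X, ∑ j ∈ X,
      if (G.collapse R φ).Adj (.inr i) (.inr j) then (1 : ℤ) else 0) =
        X.card * (X.card - 1) := by
    have : ∀ i ∈ X, (∑ j ∈ X,
        if (G.collapse R φ).Adj (.inr i) (.inr j) then (1 : ℤ) else 0) = X.card - 1 := by
      intro i hi
      rw [Finset.sum_boole]
      have : X.filter (fun j => (G.collapse R φ).Adj (.inr i) (.inr j)) = X.erase i := by
        ext j
        rw [Finset.mem_filter, Finset.mem_erase]
        exact ⟨fun h => ⟨Ne.symm h.2, h.1⟩, fun h => ⟨h.2, Ne.symm h.1⟩⟩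
      rw [this, Finset.card_erase_of_mem hi, Nat.cast_sub (Finset.card_pos.2 ⟨i, hi⟩)]
      simp
    rw [Finset.sum_congr rfl this, Finset.sum_const, nsmul_eq_mul]
  have h5 : (G.collapse R φ).crossCount (U.disjSum X) (U.disjSum X) ≤
      G.crossCount U U + 2 * G.crossCount U (R.filter fun y => φ y ∈ X)
        + X.card * (X.card - 1) := by
    have : (∑ u ∈ U, ∑ w ∈ U, if (G.collapse R φ).Adj (.inl u) (.inl w) then (1 : ℤ) else 0) =
      G.crossCount U U := rfl
    unfold crossCount at *
    simp only [Finset.sum_disjSum, Finset.sum_add_distrib]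
    linarith
  unfold potential
  rw [Finset.card_disjSum]
  push_cast
  linarith

/-- A graph on `A` violating the Kostochka–Yancey bound, with `A` as small as possible. -/
structure IsMinimalSparse (G : SimpleGraph V) (A : Finset V) : Prop where
  not_col : ¬ G.ColorableOn A
  pot : 4 < G.potential A
  sub : ∀ S, S ⊂ A → G.ColorableOn S
  ih : ∀ {W : Type u} (G' : SimpleGraph W) (B : Finset W), B.card < A.card →
    ¬ G'.ColorableOn B → ∃ S ⊆ B, G'.potential S ≤ 4 ∧ ¬ G'.ColorableOn S

namespace IsMinimalSparse

variable {G : SimpleGraph V} {A : Finset V}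

lemma exists_extension (h : G.IsMinimalSparse A) {R : Finset V} (hR : R ⊂ A) (hcard : 4 ≤ R.card)
    {φ : V → Fin 3} (hφ : ∀ u ∈ R, ∀ w ∈ R, G.Adj u w → φ u ≠ φ w) :
    ∃ U ⊆ A \ R, U.Nonempty ∧ ∃ X : Finset (Fin 3), X.Nonempty ∧
      G.potential (R ∪ U) + (10 * X.card - 3 * (X.card * (X.card - 1))) +
        6 * G.crossCount U (R.filter fun y => φ y ∉ X) ≤ G.potential R + 4 := by
  have hlt : ((A \ R).disjSum (Finset.univ : Finset (Fin 3))).card < A.card := by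
    rw [Finset.card_disjSum, Finset.card_sdiff_of_subset hR.1]
    have := Finset.card_lt_card hR
    simp
    omega
  obtain ⟨W, hW, hpot, hcol⟩ := h.ih _ _ hlt (not_colorableOn_collapse h.not_col hφ)
  have hWd : W.toLeft.disjSum W.toRight = W := Finset.toLeft_disjSum_toRight
  have hU : W.toLeft ⊆ A \ R := fun x hx => by
    simpa using hW (Finset.mem_toLeft.1 hx)
  refine ⟨W.toLeft, hU, ?_, W.toRight, ?_, ?_⟩
  · by_contra hne
    rw [Finset.not_nonempty_iff_eq_empty] at hne
    have h4 := four_le_card_of_not_colorableOn hcol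
    rw [← hWd, hne, Finset.card_disjSum] at h4
    have := W.toRight.card_le_univ
    simp at h4 this
    omega
  · by_contra hne
    rw [Finset.not_nonempty_iff_eq_empty] at hne
    have hss : W.toLeft ⊂ A := by
      refine (hU.trans Finset.sdiff_subset).ssubset_of_ne ?_
      rintro heq
      obtain ⟨r, hr⟩ := Finset.card_pos.1 (by omega : 0 < R.card)
      have := hU (heq ▸ hR.1 hr)
      simp [hr] at this
    obtain ⟨c, hc⟩ := h.sub _ hss
    refine hcol ⟨Sum.elim c 0, ?_⟩
    rw [← hWd, hne]
    rintro (u | i) hu (w | j) hw huw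
    · exact hc u (by simpa using hu) w (by simpa using hw) huw
    all_goals simp at hu hw
  · have h1 := G.potential_disjSum_collapse R W.toLeft φ W.toRight
    rw [hWd] at h1
    have hd : Disjoint R W.toLeft := by
      refine Finset.disjoint_left.2 fun x hx hx' => ?_
      have := hU hx'
      simp [hx] at this
    have h2 := G.potential_union hd
    have h3 : G.crossCount W.toLeft (R.filter fun y => φ y ∈ W.toRight) +
        G.crossCount W.toLeft (R.filter fun y => φ y ∉ W.toRight) = G.crossCount R W.toLeft := by
      rw [← crossCount_union_right _ _ (Finset.disjoint_filter_filter_not _ _ _),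
        Finset.filter_union_filter_not_eq, crossCount_comm]
    linarith

lemma twelve_le_potential (h : G.IsMinimalSparse A) {R : Finset V} (hR : R ⊂ A)
    (hcard : 2 ≤ R.card) : 12 ≤ G.potential R := by
  induction hn : A.card - R.card using Nat.strong_induction_on generalizing R with
  | _ n ih =>
    by_cases h4 : 4 ≤ R.card
    · by_contra! hlt
      obtain ⟨φ, hφ⟩ := h.sub R hR
      obtain ⟨U, hU, hUne, X, hX, hpot⟩ := h.exists_extension hR h4 hφ
      have hc := G.crossCount_nonneg U (R.filter fun y => φ y ∉ X)
      have hX1 : 1 ≤ X.card := hX.card_pos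
      have hX3 : X.card ≤ 3 := by simpa using X.card_le_univ
      have hXp : (10 : ℤ) ≤ 10 * X.card - 3 * (X.card * (X.card - 1)) := by
        interval_cases X.card <;> norm_num
      obtain ⟨k, hk⟩ := G.even_potential R
      obtain ⟨u, hu⟩ := hUne
      have huR := hU hu
      rw [Finset.mem_sdiff] at huR
      by_cases hA : R ∪ U = A
      · have := h.pot
        rw [hA] at hpot
        omega
      · have hss : R ∪ U ⊂ A :=
          (Finset.union_subset hR.1 (hU.trans Finset.sdiff_subset)).ssubset_of_ne hA
        have hlt1 : R.card < (R ∪ U).card :=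
          Finset.card_lt_card ⟨Finset.subset_union_left, fun hh => huR.2 (hh (by simp [hu]))⟩
        have hlt2 := Finset.card_lt_card hss
        have := ih _ (by omega) hss (by omega) rfl
        omega
    · have := G.crossCount_self_le R
      have h3 : R.card = 2 ∨ R.card = 3 := by omega
      unfold potential
      rcases h3 with h3 | h3 <;> rw [h3] at this ⊢ <;> push_cast at * <;> linarith

end IsMinimalSparse


lemma proper_update {G : SimpleGraph V} {S : Finset V} {x : V} {k : Fin 3} {c : V → Fin 3}
    (hc : ∀ u ∈ S.erase x, ∀ w ∈ S.erase x, G.Adj u w → c u ≠ c w)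
    (hk : ∀ y ∈ S, G.Adj x y → c y ≠ k) :
    ∀ u ∈ S, ∀ w ∈ S, G.Adj u w → Function.update c x k u ≠ Function.update c x k w := by
  intro u hu w hw huw
  by_cases hux : u = x <;> by_cases hwx : w = x
  · exact absurd (hux.trans hwx.symm) huw.ne
  · subst hux
    simpa [hwx] using (hk w hw huw).symm
  · subst hwx
    simpa [hux] using hk u hu huw.symm
  · simpa [hux, hwx] using hc u (by simp [hu, hux]) w (by simp [hw, hwx]) huw

namespace IsMinimalSparse

variable {G : SimpleGraph V} {A : Finset V}

/-- A minimal sparse graph has no cut vertex. -/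
lemma exists_pair_boundary (h : G.IsMinimalSparse A) {R : Finset V} (hR : R ⊂ A)
    (hcard : 2 ≤ R.card) : ∃ u ∈ R, ∃ v ∈ R, u ≠ v ∧ (∃ w ∈ A \ R, G.Adj w u) ∧
      ∃ w ∈ A \ R, G.Adj w v := by
  by_contra! hcon
  obtain ⟨u, hu, hu'⟩ : ∃ u ∈ R, ∀ v ∈ R, u ≠ v → ∀ w ∈ A \ R, ¬ G.Adj w v := by
    by_cases hex : ∃ u ∈ R, ∃ w ∈ A \ R, G.Adj w u
    · obtain ⟨u, hu, hw⟩ := hex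
      exact ⟨u, hu, fun v hv huv => hcon u hu v hv huv hw⟩
    · push Not at hex
      obtain ⟨u, hu⟩ := Finset.card_pos.1 (by omega : 0 < R.card)
      exact ⟨u, hu, fun v hv _ => hex v hv⟩
  obtain ⟨c₁, hc₁⟩ := h.sub R hR
  have hss : insert u (A \ R) ⊂ A := by
    refine (Finset.insert_subset (hR.1 hu) Finset.sdiff_subset).ssubset_of_ne fun heq => ?_
    obtain ⟨v, hv, hvu⟩ := Finset.exists_mem_ne (by omega : 1 < R.card) u
    have := heq ▸ hR.1 hv
    simp [hvu, hv] at this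
  obtain ⟨c₂, hc₂⟩ := h.sub _ hss
  set e := Equiv.swap (c₂ u) (c₁ u) with he
  have heu : e (c₂ u) = c₁ u := Equiv.swap_apply_left _ _
  have hcross : ∀ x ∈ R, ∀ y ∈ A, y ∉ R → G.Adj y x → e (c₂ y) ≠ c₁ x := by
    intro x hx y hy hyR hxy
    have hxu : u = x := by
      by_contra hne
      exact hu' x hx hne y (by simp [hy, hyR]) hxy
    subst hxu
    rw [← heu]
    exact fun heq => hc₂ y (by simp [hy, hyR]) u (by simp) hxy (e.injective heq)
  refine h.not_col ⟨fun x => if x ∈ R then c₁ x else e (c₂ x), fun x hx y hy hxy => ?_⟩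
  by_cases hxR : x ∈ R <;> by_cases hyR : y ∈ R <;> simp only [hxR, hyR, if_true, if_false]
  · exact hc₁ x hxR y hyR hxy
  · exact (hcross x hxR y hy hyR hxy.symm).symm
  · exact hcross y hyR x hx hxR hxy
  · exact fun heq => hc₂ x (by simp [hx, hxR]) y (by simp [hy, hyR]) hxy (e.injective heq)

/-- Adding an edge inside a small set keeps it three-colourable. -/
lemma colorableOn_sup_edge (h : G.IsMinimalSparse A) {R : Finset V} (hR : R ⊂ A) (a b : V) :
    (G ⊔ edge a b).ColorableOn R := by
  by_contra hcol
  obtain ⟨S, hS, hpot, hScol⟩ := h.ih _ R (Finset.card_lt_card hR) hcol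
  have h1 := G.potential_le_potential_sup_edge (a := a) (b := b) S
  have h2 := h.twelve_le_potential (Finset.ssubset_of_subset_of_ssubset hS hR)
    (by have := four_le_card_of_not_colorableOn hScol; omega)
  omega

lemma fourteen_le_potential (h : G.IsMinimalSparse A) {R : Finset V} (hR : R ⊂ A)
    (hcard : 4 ≤ R.card) : 14 ≤ G.potential R := by
  by_contra! hlt
  obtain ⟨u, hu, v, hv, huv, ⟨p, hp, hpu⟩, ⟨q, hq, hqv⟩⟩ :=
    h.exists_pair_boundary hR (by omega)
  obtain ⟨φ, hφ⟩ := h.colorableOn_sup_edge hR u v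
  have huv' : φ u ≠ φ v := hφ u hu v hv (by simp [edge_adj, huv])
  obtain ⟨U, hU, -, X, hX, hpot⟩ := h.exists_extension hR hcard
    (φ := φ) fun x hx y hy hxy => hφ x hx y hy (Or.inl hxy)
  have hc := G.crossCount_nonneg U (R.filter fun y => φ y ∉ X)
  have hX1 : 1 ≤ X.card := hX.card_pos
  have hX3 : X.card ≤ 3 := by simpa using X.card_le_univ
  obtain ⟨k, hk⟩ := G.even_potential R
  have hnext : R ∪ U ≠ A → 12 ≤ G.potential (R ∪ U) := fun hne =>
    h.twelve_le_potential
      ((Finset.union_subset hR.1 (hU.trans Finset.sdiff_subset)).ssubset_of_ne hne)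
      ((by omega : 2 ≤ R.card).trans (Finset.card_le_card Finset.subset_union_left))
  have hApot := h.pot
  by_cases hX2 : X.card = 1
  · rw [hX2] at hpot
    by_cases hA : R ∪ U = A
    · have hUeq : ∀ x ∈ A \ R, x ∈ U := by
        intro x hx
        rw [Finset.mem_sdiff, ← hA, Finset.mem_union] at hx
        tauto
      obtain ⟨i, rfl⟩ := Finset.card_eq_one.1 hX2
      have : 1 ≤ G.crossCount U (R.filter fun y => φ y ∉ ({i} : Finset (Fin 3))) := by
        by_cases hui : φ u = i
        · refine crossCount_pos G (hUeq q hq) ?_ hqv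
          simp only [Finset.mem_filter, Finset.mem_singleton]
          exact ⟨hv, fun hvi => huv' (hui.trans hvi.symm)⟩
        · exact crossCount_pos G (hUeq p hp) (by simp [hu, hui]) hpu
      rw [hA] at hpot
      push_cast at hpot
      omega
    · have := hnext hA
      push_cast at hpot
      omega
  · have hXp : (12 : ℤ) ≤ 10 * X.card - 3 * (X.card * (X.card - 1)) := by
      interval_cases X.card
      · exact absurd rfl hX2
      all_goals norm_num
    by_cases hA : R ∪ U = A
    · rw [hA] at hpot
      omega
    · have := hnext hA
      omega

lemma three_le_degree (h : G.IsMinimalSparse A) {x : V} (hx : x ∈ A) :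
    3 ≤ (A.filter (G.Adj x)).card := by
  by_contra! hlt
  obtain ⟨c, hc⟩ := h.sub _ (Finset.erase_ssubset hx)
  obtain ⟨k, hk⟩ : ∃ k : Fin 3, k ∉ (A.filter (G.Adj x)).image c := by
    by_contra! hall
    have := Finset.card_le_card (fun k _ => hall k : (Finset.univ : Finset (Fin 3)) ⊆ _)
    have := Finset.card_image_le (f := c) (s := A.filter (G.Adj x))
    simp at *
    omega
  have hk' : ∀ y ∈ A, G.Adj x y → c y ≠ k := fun y hy hxy heq =>
    hk (Finset.mem_image.2 ⟨y, by simp [hy, hxy], heq⟩)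
  exact h.not_col ⟨_, proper_update hc hk'⟩

lemma five_le_card (h : G.IsMinimalSparse A) : 5 ≤ A.card := by
  have h4 := four_le_card_of_not_colorableOn h.not_col
  by_contra! hlt
  have hA : A.card = 4 := by omega
  have hpot := h.pot
  have : (A.card : ℤ) * 3 ≤ G.crossCount A A := by
    rw [crossCount_eq_sum, ← nsmul_eq_mul]
    refine Finset.card_nsmul_le_sum _ _ _ fun x hx => ?_
    exact_mod_cast h.three_le_degree hx
  unfold potential at hpot
  rw [hA] at *
  push_cast at *
  omega

/-- A triangle contains at most one vertex of degree three. -/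
lemma not_triangle (h : G.IsMinimalSparse A) {x₁ x₂ x₃ a b : V} (h3 : x₃ ∈ A)
    (hN₁ : A.filter (G.Adj x₁) = {x₂, x₃, a}) (hN₂ : A.filter (G.Adj x₂) = {x₁, x₃, b})
    (h23 : x₂ ≠ x₃) (h13 : x₁ ≠ x₃) (ha2 : a ≠ x₂) (ha3 : a ≠ x₃) (hb1 : b ≠ x₁)
    (hb3 : b ≠ x₃) : False := by
  have n₁ : ∀ y, (y ∈ A ∧ G.Adj x₁ y) ↔ (y = x₂ ∨ y = x₃ ∨ y = a) := fun y => by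
    rw [← Finset.mem_filter, hN₁]; simp
  have n₂ : ∀ y, (y ∈ A ∧ G.Adj x₂ y) ↔ (y = x₁ ∨ y = x₃ ∨ y = b) := fun y => by
    rw [← Finset.mem_filter, hN₂]; simp
  obtain ⟨h2A, h12⟩ := (n₁ x₂).2 (by simp)
  obtain ⟨h1A, -⟩ := (n₂ x₁).2 (by simp)
  obtain ⟨-, h13'⟩ := (n₁ x₃).2 (by simp)
  obtain ⟨-, h23'⟩ := (n₂ x₃).2 (by simp)
  obtain ⟨haA, h1a⟩ := (n₁ a).2 (by simp)
  obtain ⟨hbA, h2b⟩ := (n₂ b).2 (by simp)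
  have hab : a ≠ b := by
    rintro rfl
    have hsub : ({x₁, x₂, x₃, a} : Finset V) ⊆ A := by
      intro y
      simp only [Finset.mem_insert, Finset.mem_singleton]
      rintro (rfl | rfl | rfl | rfl) <;> assumption
    have h1n : x₁ ∉ ({x₂, x₃, a} : Finset V) := by simp [h12.ne, h13, hb1.symm]
    have h2n : x₂ ∉ ({x₃, a} : Finset V) := by simp [h23, ha2.symm]
    have h3n : x₃ ∉ ({a} : Finset V) := by simp [ha3.symm]
    have hcard : ({x₁, x₂, x₃, a} : Finset V).card = 4 := by
      rw [Finset.card_insert_of_notMem h1n, Finset.card_insert_of_notMem h2n,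
        Finset.card_insert_of_notMem h3n, Finset.card_singleton]
    have hss : ({x₁, x₂, x₃, a} : Finset V) ⊂ A := by
      refine hsub.ssubset_of_ne fun heq => ?_
      have := h.five_le_card
      rw [← heq] at this
      omega
    have hpot := h.fourteen_le_potential hss hcard.ge
    have c1 : G.crossCount {x₁} {x₂, x₃, a} = 3 := by
      rw [crossCount_singleton, Finset.filter_true_of_mem]
      · rw [Finset.card_insert_of_notMem h2n,
          Finset.card_insert_of_notMem h3n, Finset.card_singleton]; rfl
      · simp [h12, h13', h1a]
    have c2 : G.crossCount {x₂} {x₃, a} = 2 := by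
      rw [crossCount_singleton, Finset.filter_true_of_mem]
      · rw [Finset.card_insert_of_notMem h3n, Finset.card_singleton]; rfl
      · simp [h23', h2b]
    have c3 := G.crossCount_nonneg {x₃} {a}
    rw [potential_insert _ h1n, potential_insert _ h2n, potential_insert _ h3n, c1, c2,
      potential, crossCount_singleton_self, Finset.card_singleton] at hpot
    push_cast at hpot
    omega
  have hss : (A.erase x₁).erase x₂ ⊂ A :=
    Finset.ssubset_of_subset_of_ssubset (Finset.erase_subset _ _) (Finset.erase_ssubset h1A)
  obtain ⟨c, hc⟩ := h.colorableOn_sup_edge hss a b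
  have hcab : c a ≠ c b := hc a (by simp [haA, ha2, h1a.ne']) b (by simp [hbA, hb1, h2b.ne'])
    (by simp [edge_adj, hab])
  obtain ⟨p, q, hpq, hp3, hpa, hq3, hqb⟩ : ∃ p q : Fin 3, p ≠ q ∧ p ≠ c x₃ ∧ p ≠ c a ∧
      q ≠ c x₃ ∧ q ≠ c b := by
    generalize c x₃ = α, c a = β, c b = γ at *
    revert α β γ
    decide
  have hP : ∀ y ∈ A, G.Adj x₁ y → y ≠ x₂ → c y ≠ p := by
    intro y hy hxy hy2
    rcases (n₁ y).1 ⟨hy, hxy⟩ with rfl | rfl | rfl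
    exacts [absurd rfl hy2, hp3.symm, hpa.symm]
  have hQ : ∀ y ∈ A, G.Adj x₂ y → y ≠ x₁ → c y ≠ q := by
    intro y hy hxy hy2
    rcases (n₂ y).1 ⟨hy, hxy⟩ with rfl | rfl | rfl
    exacts [absurd rfl hy2, hq3.symm, hqb.symm]
  refine h.not_col ⟨fun y => if y = x₁ then p else if y = x₂ then q else c y,
    fun u hu w hw huw => ?_⟩
  by_cases hu1 : u = x₁
  · subst hu1
    by_cases hw2 : w = x₂
    · subst hw2
      simp [huw.ne', hpq]
    · simpa [huw.ne', hw2] using (hP w hw huw hw2).symm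
  · by_cases hw1 : w = x₁
    · subst hw1
      by_cases hu2 : u = x₂
      · subst hu2
        simp [hu1, hpq.symm]
      · simpa [hu1, hu2] using hP u hu huw.symm hu2
    · by_cases hu2 : u = x₂
      · subst hu2
        simpa [hu1, hw1, huw.ne'] using (hQ w hw huw hw1).symm
      · by_cases hw2 : w = x₂
        · subst hw2
          simpa [hu1, hw1, hu2] using hQ u hu huw.symm hu1
        · simpa [hu1, hu2, hw1, hw2] using
            hc u (by simp [hu, hu1, hu2]) w (by simp [hw, hw1, hw2]) (Or.inl huw)

end IsMinimalSparse


/-- The graph obtained from `G` by giving `u` all the neighbours of `v`. -/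
def absorb (G : SimpleGraph V) (u v : V) : SimpleGraph V :=
  fromRel fun p q => G.Adj p q ∨ (p = u ∧ G.Adj v q)

lemma crossCount_absorb_le (G : SimpleGraph V) {u v : V} {S : Finset V} (hu : u ∉ S) :
    (G.absorb u v).crossCount (insert u S) (insert u S) ≤
      G.crossCount S S + 2 * (G.crossCount {u} S + G.crossCount {v} S) := by
  have h1 : (G.absorb u v).crossCount S S = G.crossCount S S := by
    refine Finset.sum_congr rfl fun p hp => Finset.sum_congr rfl fun q hq => ?_
    have hpu : p ≠ u := fun h => hu (h ▸ hp)
    have hqu : q ≠ u := fun h => hu (h ▸ hq)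
    have : (G.absorb u v).Adj p q ↔ G.Adj p q := by
      simp only [absorb, fromRel_adj, hpu, hqu, false_and, or_false, G.adj_comm q p, or_self]
      exact ⟨And.right, fun h => ⟨h.ne, h⟩⟩
    simp only [this]
  have h2 : (G.absorb u v).crossCount {u} S ≤ G.crossCount {u} S + G.crossCount {v} S := by
    simp only [crossCount_singleton]
    norm_cast
    refine (Finset.card_le_card ?_).trans (Finset.card_union_le _ _)
    intro q hq
    obtain ⟨hqS, hq⟩ := Finset.mem_filter.1 hq
    have hqu : q ≠ u := fun h => hu (h ▸ hqS)
    simp only [absorb, fromRel_adj, hqu, false_and, or_false, true_and, G.adj_comm q u] at hq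
    simp only [Finset.mem_union, Finset.mem_filter, hqS, true_and]
    tauto
  rw [crossCount_insert_self _ hu, h1]
  linarith

namespace IsMinimalSparse

variable {G : SimpleGraph V} {A : Finset V}

lemma adj_of_adjacent_degree_three (h : G.IsMinimalSparse A) {x y u v : V}
    (hx : x ∈ A) (hN : A.filter (G.Adj x) = {y, u, v}) (hyu : y ≠ u) (hyv : y ≠ v) (huv : u ≠ v)
    (hdy : (A.filter (G.Adj y)).card = 3) : G.Adj u v := by
  by_contra hnadj
  have n : ∀ z, (z ∈ A ∧ G.Adj x z) ↔ (z = y ∨ z = u ∨ z = v) := fun z => by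
    rw [← Finset.mem_filter, hN]; simp
  obtain ⟨hyA, hxy⟩ := (n y).2 (by simp)
  obtain ⟨huA, hxu⟩ := (n u).2 (by simp)
  obtain ⟨hvA, hxv⟩ := (n v).2 (by simp)
  set B := ((A.erase x).erase y).erase v with hB
  have hBA : B ⊆ (A.erase x).erase y := Finset.erase_subset _ _
  have hBlt : B ⊂ A := Finset.ssubset_of_subset_of_ssubset
    (hBA.trans (Finset.erase_subset _ _)) (Finset.erase_ssubset hx)
  have huB : u ∈ B := by simp [hB, huA, huv, hyu.symm, hxu.ne']
  have hcol : ¬ (G.absorb u v).ColorableOn B := by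
    rintro ⟨c, hc⟩
    have hcG : ∀ p ∈ B, ∀ q ∈ B, G.Adj p q → c p ≠ c q := fun p hp q hq hpq =>
      hc p hp q hq (by simp [absorb, hpq.ne, hpq])
    have h1 := proper_update (G := G) (S := (A.erase x).erase y) (x := v) (k := c u) hcG
      (by
        intro z hz hvz
        have hzu : z ≠ u := fun hh => hnadj (hh ▸ hvz.symm)
        exact hc z (by simp [hB, hvz.ne', Finset.mem_erase.1 hz |>.1, Finset.mem_erase.1 hz |>.2])
          u huB (by simp [absorb, hzu, hvz]))
    set c₁ := Function.update c v (c u) with hc₁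
    obtain ⟨k, hk⟩ : ∃ k : Fin 3, k ∉ ((A.filter (G.Adj y)).erase x).image c₁ := by
      by_contra! hall
      have h1 := Finset.card_le_card (fun k _ => hall k : (Finset.univ : Finset (Fin 3)) ⊆ _)
      have h2 := Finset.card_image_le (f := c₁) (s := (A.filter (G.Adj y)).erase x)
      rw [Finset.card_erase_of_mem (by simp [hx, hxy.symm]), hdy] at h2
      simp at h1
      omega
    have h2 := proper_update (G := G) (S := A.erase x) (x := y) (k := k) h1
      (by
        intro z hz hyz heq
        refine hk (Finset.mem_image.2 ⟨z, ?_, heq⟩)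
        simp [hyz, Finset.mem_erase.1 hz |>.1, Finset.mem_erase.1 hz |>.2])
    set c₂ := Function.update c₁ y k with hc₂
    have hu2 : c₂ u = c u := by simp [hc₂, hc₁, hyu.symm, huv]
    have hv2 : c₂ v = c u := by simp [hc₂, hc₁, hyv.symm]
    obtain ⟨m, hm1, hm2⟩ : ∃ m : Fin 3, m ≠ c₂ y ∧ m ≠ c u := by
      generalize c₂ y = α, c u = β
      revert α β
      decide
    refine h.not_col ⟨_, proper_update (x := x) (k := m) h2 ?_⟩
    intro z hz hxz
    rcases (n z).1 ⟨hz, hxz⟩ with rfl | rfl | rfl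
    · exact hm1.symm
    · rw [hu2]; exact hm2.symm
    · rw [hv2]; exact hm2.symm
  obtain ⟨S, hS, hpot, hScol⟩ := h.ih _ B (Finset.card_lt_card hBlt) hcol
  have huS : u ∈ S := by
    by_contra huS
    obtain ⟨c, hc⟩ := h.sub S (Finset.ssubset_of_subset_of_ssubset hS hBlt)
    refine hScol ⟨c, fun p hp q hq hpq => hc p hp q hq ?_⟩
    have hpu : p ≠ u := fun h => huS (h ▸ hp)
    have hqu : q ≠ u := fun h => huS (h ▸ hq)
    simpa [absorb, hpu, hqu, G.adj_comm q p] using hpq.2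
  have hvS : v ∉ S := fun hv => by simpa [hB] using hS hv
  have hyS : y ∉ S := fun hy => by simpa [hB] using hS hy
  have hxS : x ∉ S := fun hx => by simpa [hB] using hS hx
  obtain ⟨T, huT, rfl⟩ : ∃ T, u ∉ T ∧ S = insert u T :=
    ⟨S.erase u, by simp, (Finset.insert_erase huS).symm⟩
  have hSA := hS.trans hBlt.1
  have hvT : v ∉ insert u T := hvS
  have hxT : x ∉ insert v (insert u T) := by
    simp only [Finset.mem_insert, not_or] at hxS ⊢
    exact ⟨hxv.ne, hxS⟩
  have hss : insert x (insert v (insert u T)) ⊂ A := by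
    refine (Finset.insert_subset hx (Finset.insert_subset hvA hSA)).ssubset_of_ne fun heq => ?_
    rw [← heq] at hyA
    simp only [Finset.mem_insert] at hyA hyS
    have := hxy.ne'
    tauto
  have hScard := four_le_card_of_not_colorableOn hScol
  have h14 := h.fourteen_le_potential hss
    (hScard.trans (Finset.card_le_card
      ((Finset.subset_insert _ _).trans (Finset.subset_insert _ _))))
  have hab := G.crossCount_absorb_le (v := v) huT
  have hx2 : 2 ≤ G.crossCount {x} (insert v (insert u T)) := by
    rw [crossCount_singleton]
    have : ({v, u} : Finset V) ⊆ (insert v (insert u T)).filter (G.Adj x) := by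
      intro z
      simp only [Finset.mem_insert, Finset.mem_singleton, Finset.mem_filter]
      rintro (rfl | rfl) <;> simp [hxu, hxv]
    have := Finset.card_le_card this
    rw [Finset.card_pair huv.symm] at this
    exact_mod_cast this
  have hvu : G.crossCount {v} T ≤ G.crossCount {v} (insert u T) :=
    crossCount_mono_right _ _ (Finset.subset_insert _ _)
  rw [potential_insert _ hxT, potential_insert _ hvT, potential, crossCount_insert_self _ huT]
    at h14
  unfold potential at hpot
  linarith

lemma unique_degree_three_neighbor (h : G.IsMinimalSparse A) {x : V} (hx : x ∈ A)
    (hdx : (A.filter (G.Adj x)).card = 3) :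
    ((A.filter fun y => (A.filter (G.Adj y)).card = 3).filter (G.Adj x)).card ≤ 1 := by
  rw [Finset.card_le_one]
  intro y hy z hz
  simp only [Finset.mem_filter] at hy hz
  obtain ⟨⟨hyA, hdy⟩, hxy⟩ := hy
  obtain ⟨⟨hzA, hdz⟩, hxz⟩ := hz
  by_contra hyz
  obtain ⟨v, hv⟩ : ∃ v, v ∈ ((A.filter (G.Adj x)).erase y).erase z := by
    refine Finset.card_pos.1 ?_
    rw [Finset.card_erase_of_mem (by simp [hzA, hxz, Ne.symm hyz]),
      Finset.card_erase_of_mem (by simp [hyA, hxy]), hdx]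
    norm_num
  simp only [Finset.mem_erase, Finset.mem_filter] at hv
  obtain ⟨hvz, hvy, hvA, hxv⟩ := hv
  have hNx : ({z, v, y} : Finset V) = A.filter (G.Adj x) := by
    refine Finset.eq_of_subset_of_card_le ?_ ?_
    · intro w
      simp only [Finset.mem_insert, Finset.mem_singleton, Finset.mem_filter]
      rintro (rfl | rfl | rfl) <;> simp [*]
    · rw [hdx, Finset.card_insert_of_notMem (by simp [Ne.symm hvz, Ne.symm hyz]),
        Finset.card_pair hvy]
  have hvz' : G.Adj z v := h.adj_of_adjacent_degree_three hx (y := y) (u := z) (v := v)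
    (by rw [← hNx]; ext; simp; tauto) hyz hvy.symm hvz.symm hdy
  obtain ⟨b, hb⟩ : ∃ b, b ∈ ((A.filter (G.Adj z)).erase x).erase v := by
    refine Finset.card_pos.1 ?_
    rw [Finset.card_erase_of_mem (by simp [hvA, hvz', hxv.ne']),
      Finset.card_erase_of_mem (by simp [hx, hxz.symm]), hdz]
    norm_num
  simp only [Finset.mem_erase, Finset.mem_filter] at hb
  obtain ⟨hbv, hbx, hbA, hzb⟩ := hb
  have hNz : ({x, v, b} : Finset V) = A.filter (G.Adj z) := by
    refine Finset.eq_of_subset_of_card_le ?_ ?_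
    · intro w
      simp only [Finset.mem_insert, Finset.mem_singleton, Finset.mem_filter]
      rintro (rfl | rfl | rfl) <;> simp [*, hxz.symm]
    · rw [hdz, Finset.card_insert_of_notMem (by simp [hxv.ne, Ne.symm hbx]),
        Finset.card_pair hbv.symm]
  exact h.not_triangle hvA hNx.symm hNz.symm hvz.symm hxv.ne hyz hvy.symm hbx hbv

lemma false_of_isMinimalSparse (h : G.IsMinimalSparse A) : False := by
  set B := A.filter fun y => (A.filter (G.Adj y)).card = 3 with hB
  set C := A.filter fun y => ¬ (A.filter (G.Adj y)).card = 3 with hC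
  have hBC : Disjoint B C := Finset.disjoint_filter_filter_not _ _ _
  have hA : B ∪ C = A := Finset.filter_union_filter_not_eq _ _
  have h1 : G.crossCount B A = B.card * 3 := by
    rw [crossCount_eq_sum, Finset.sum_congr rfl (g := fun _ => (3 : ℤ))]
    · simp
    · intro x hx
      exact_mod_cast (Finset.mem_filter.1 hx).2
  have h2 : (C.card : ℤ) * 4 ≤ G.crossCount C A := by
    rw [crossCount_eq_sum, ← nsmul_eq_mul]
    refine Finset.card_nsmul_le_sum _ _ _ fun x hx => ?_
    obtain ⟨hxA, hx⟩ := Finset.mem_filter.1 hx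
    have := h.three_le_degree hxA
    have : 4 ≤ (A.filter (G.Adj x)).card := by omega
    exact_mod_cast this
  have h3 : G.crossCount B B ≤ B.card * 1 := by
    rw [crossCount_eq_sum, ← nsmul_eq_mul]
    refine Finset.sum_le_card_nsmul _ _ _ fun x hx => ?_
    obtain ⟨hxA, hx⟩ := Finset.mem_filter.1 hx
    exact_mod_cast h.unique_degree_three_neighbor hxA hx
  have h4 : G.crossCount B A = G.crossCount B B + G.crossCount B C := by
    rw [← crossCount_union_right _ _ hBC, hA]
  have h5 : G.crossCount C A = G.crossCount B C + G.crossCount C C := by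
    rw [G.crossCount_comm B C, ← crossCount_union_right _ _ hBC, hA]
  have h6 : G.crossCount A A = G.crossCount B A + G.crossCount C A := by
    rw [← crossCount_union_left _ _ hBC, hA]
  have h7 := G.crossCount_nonneg C C
  have h8 : B.card + C.card = A.card := by rw [← Finset.card_union_of_disjoint hBC, hA]
  have h9 := h.pot
  unfold potential at h9
  rw [← h8] at h9
  push_cast at h9
  linarith

end IsMinimalSparse

/-- **Kostochka–Yancey**: a graph that is not three-colourable has a non-three-colourable induced
subgraph with `n` vertices and at least `(5 n - 2) / 3` edges. -/
theorem exists_potential_le_of_not_colorableOn (G : SimpleGraph V) (A : Finset V)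
    (hA : ¬ G.ColorableOn A) : ∃ S ⊆ A, G.potential S ≤ 4 ∧ ¬ G.ColorableOn S := by
  induction hn : A.card using Nat.strong_induction_on generalizing V with
  | _ n ih =>
    subst hn
    by_contra! hcon
    have hsub : ∀ S, S ⊂ A → G.ColorableOn S := by
      intro S hS
      by_contra hScol
      obtain ⟨T, hT, hpot, hTcol⟩ := ih _ (Finset.card_lt_card hS) G S hScol rfl
      exact hTcol (hcon T (hT.trans hS.1) hpot)
    refine IsMinimalSparse.false_of_isMinimalSparse (G := G) (A := A) ⟨hA, ?_, hsub, ?_⟩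
    · by_contra! hle
      exact hA (hcon A subset_rfl hle)
    · intro W G' B hB hBcol
      exact ih _ hB G' B hBcol rfl

end KostochkaYancey
end SimpleGraph

section Duality

variable {E E' V' : Type*} {ι : Type w}

/-- The multigraph with edge ends `l`, `r` is an abstract dual of the one with edge ends `s`, `t`:
the cycle space of the latter is the cut space of the former. -/
def IsAbstractDual [Fintype E] (s t : E → V) (l r : E → ι) : Prop :=
  ∀ z : E → ZMod 2, (∀ τ : V → ZMod 2, ∑ e, z e * (τ (s e) + τ (t e)) = 0) ↔
    ∃ σ : ι → ZMod 2, ∀ e, z e = σ (l e) + σ (r e)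

namespace IsAbstractDual

lemma symm [Fintype E] {s t : E → V} {l r : E → ι} (h : IsAbstractDual s t l r) :
    IsAbstractDual l r s t := by
  classical
  intro y
  constructor
  · intro hy
    let δ : (V → ZMod 2) →ₗ[ZMod 2] (E → ZMod 2) :=
      LinearMap.funLeft _ _ s + LinearMap.funLeft _ _ t
    have hδ : ∀ τ e, δ τ e = τ (s e) + τ (t e) := fun τ e => rfl
    by_contra hcon
    have hmem : y ∉ LinearMap.range δ := by
      rintro ⟨τ, hτ⟩
      exact hcon ⟨τ, fun e => by rw [← hτ, hδ]⟩
    obtain ⟨f, hf, hle⟩ := Submodule.exists_le_ker_of_notMem hmem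
    have hf' : ∀ x, f x = ∑ e, f (Pi.single e 1) * x e := by
      intro x
      conv_lhs => rw [← Finset.univ_sum_single x]
      rw [map_sum]
      refine Finset.sum_congr rfl fun e _ => ?_
      have : (Pi.single e (x e) : E → ZMod 2) = x e • Pi.single e 1 := by
        rw [← Pi.single_smul]; simp
      rw [this, map_smul, smul_eq_mul, mul_comm]
    obtain ⟨σ, hσ⟩ := (h fun e => f (Pi.single e 1)).1 fun τ => by
      simp only [← hδ]
      rw [← hf']
      exact hle ⟨τ, rfl⟩
    refine hf ?_
    rw [hf', ← hy σ]
    exact Finset.sum_congr rfl fun e _ => by rw [hσ e, mul_comm]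
  · rintro ⟨τ, hτ⟩ σ
    rw [← (h fun e => σ (l e) + σ (r e)).2 ⟨σ, fun _ => rfl⟩ τ]
    exact Finset.sum_congr rfl fun e _ => by rw [hτ e, mul_comm]

/-- Deleting edges contracts them in the dual. -/
lemma delete [Fintype E] [Fintype E'] {s t : E → V} {l r : E → ι} (h : IsAbstractDual s t l r)
    {f : E' → E} (hf : f.Injective) :
    IsAbstractDual (s ∘ f) (t ∘ f)
      (Quot.mk (fun a b => ∃ e ∉ Set.range f, l e = a ∧ r e = b) ∘ l ∘ f)
      (Quot.mk (fun a b => ∃ e ∉ Set.range f, l e = a ∧ r e = b) ∘ r ∘ f) := by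
  intro z
  have hsum : ∀ τ : V → ZMod 2, ∑ e, z e * (τ ((s ∘ f) e) + τ ((t ∘ f) e)) =
      ∑ e, Function.extend f z 0 e * (τ (s e) + τ (t e)) := by
    intro τ
    refine Fintype.sum_of_injective f hf _ _ ?_ ?_
    · intro e he
      rw [Function.extend_apply' _ _ _ (fun ⟨a, ha⟩ => he ⟨a, ha⟩)]
      simp
    · intro e
      rw [hf.extend_apply]
      rfl
  simp only [hsum]
  rw [h]
  constructor
  · rintro ⟨σ, hσ⟩
    refine ⟨Quot.lift σ ?_, fun e => ?_⟩
    · rintro _ _ ⟨e, he, rfl, rfl⟩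
      have := hσ e
      rw [Function.extend_apply' _ _ _ (fun ⟨a, ha⟩ => he ⟨a, ha⟩)] at this
      exact CharTwo.add_eq_zero.1 this.symm
    · rw [← hf.extend_apply z 0 e]
      exact hσ (f e)
  · rintro ⟨σ, hσ⟩
    refine ⟨fun i => σ (Quot.mk _ i), fun e => ?_⟩
    by_cases he : e ∈ Set.range f
    · obtain ⟨a, rfl⟩ := he
      rw [hf.extend_apply]
      exact hσ a
    · rw [Function.extend_apply' _ _ _ (fun ⟨a, ha⟩ => he ⟨a, ha⟩)]
      have : (Quot.mk (fun a b => ∃ e ∉ Set.range f, l e = a ∧ r e = b) (l e)) =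
          Quot.mk _ (r e) := Quot.sound ⟨e, he, rfl, rfl⟩
      dsimp only [Pi.zero_apply]
      rw [this]
      exact (CharTwo.add_self_eq_zero _).symm

/-- Whether a dual exists only depends on the cut space. -/
lemma congr_cut [Fintype E] {s t : E → V} {s' t' : E → V'} {l r : E → ι}
    (h : IsAbstractDual s t l r)
    (hcut : ∀ y : E → ZMod 2, (∃ τ : V → ZMod 2, ∀ e, y e = τ (s e) + τ (t e)) ↔
      ∃ τ : V' → ZMod 2, ∀ e, y e = τ (s' e) + τ (t' e)) :
    IsAbstractDual s' t' l r := by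
  intro z
  rw [← h z]
  constructor
  · intro hz τ
    obtain ⟨σ, hσ⟩ := (hcut fun e => τ (s e) + τ (t e)).1 ⟨τ, fun _ => rfl⟩
    simpa only [hσ] using hz σ
  · intro hz τ
    obtain ⟨σ, hσ⟩ := (hcut fun e => τ (s' e) + τ (t' e)).2 ⟨τ, fun _ => rfl⟩
    simpa only [hσ] using hz σ

/-- Abstract duals pass to minors: the edges in `K` are contracted, those in the range of `f` are
kept, and the others are deleted. -/
lemma minor [Fintype E] [Fintype E'] {s t : E → V} {l r : E → ι} (h : IsAbstractDual s t l r)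
    (K : Set E) {f : E' → E} (hf : f.Injective) (hfK : ∀ e, f e ∉ K) {s' t' : E' → V'}
    (hcut : ∀ y : E' → ZMod 2,
      (∃ τ : V → ZMod 2, (∀ e ∈ K, τ (s e) = τ (t e)) ∧ ∀ e, y e = τ (s (f e)) + τ (t (f e))) ↔
      ∃ τ : V' → ZMod 2, ∀ e, y e = τ (s' e) + τ (t' e)) :
    ∃ (ι' : Type w) (l' r' : E' → ι'), IsAbstractDual s' t' l' r' := by
  classical
  let g : E' → {e // e ∈ K ∨ e ∈ Set.range f} := fun e => ⟨f e, Or.inr ⟨e, rfl⟩⟩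
  have hg : g.Injective := fun a b hab => hf (congrArg Subtype.val hab)
  have := (h.delete (f := (Subtype.val : {e // e ∈ K ∨ e ∈ Set.range f} → E))
    Subtype.val_injective).symm.delete hg
  refine ⟨_, _, _, this.symm.congr_cut fun y => ?_⟩
  rw [← hcut]
  constructor
  · rintro ⟨τ, hτ⟩
    refine ⟨fun v => τ (Quot.mk _ v), fun e he => congrArg τ (Quot.sound ?_), hτ⟩
    refine ⟨⟨e, Or.inl he⟩, ?_, rfl, rfl⟩
    rintro ⟨a, ha⟩
    exact hfK a (by rw [show f a = e from congrArg Subtype.val ha]; exact he)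
  · rintro ⟨τ, hτ, hy⟩
    refine ⟨Quot.lift τ ?_, hy⟩
    rintro _ _ ⟨⟨e, he⟩, hne, rfl, rfl⟩
    rcases he with he | ⟨a, rfl⟩
    · exact hτ e he
    · exact absurd ⟨a, rfl⟩ hne

lemma sum_ite_eq_add_ite_eq [Fintype E] [DecidableEq E] {e₁ e₂ : E} (hne : e₁ ≠ e₂)
    (g : E → ZMod 2) :
    ∑ e, (if e = e₁ ∨ e = e₂ then (1 : ZMod 2) else 0) * g e = g e₁ + g e₂ := by
  have : ∀ e, (if e = e₁ ∨ e = e₂ then (1 : ZMod 2) else 0) * g e =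
      (if e = e₁ then g e else 0) + (if e = e₂ then g e else 0) := by
    intro e
    by_cases h1 : e = e₁ <;> by_cases h2 : e = e₂ <;> simp_all
  simp [this, Finset.sum_add_distrib]

lemma add_ends_eq {s t : E → V} {e : E} {a b : V} (h : s(s e, t e) = s(a, b)) (τ : V → ZMod 2) :
    τ (s e) + τ (t e) = τ a + τ b := by
  rcases Sym2.eq_iff.1 h with ⟨h1, h2⟩ | ⟨h1, h2⟩ <;> rw [h1, h2]
  rw [add_comm]

/-- Two vertices at distance two along a face can be identified. -/
lemma identify [Fintype E] {s t : E → V} {l r : E → ι} (h : IsAbstractDual s t l r)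
    {a c d : V} (hac : a ≠ c) {e₁ e₂ : E} (hne : e₁ ≠ e₂)
    (h₁ : s(s e₁, t e₁) = s(c, d)) (h₂ : s(s e₂, t e₂) = s(d, a)) {i : ι}
    (hi₁ : ¬ (l e₁ = i ↔ r e₁ = i)) (hi₂ : ¬ (l e₂ = i ↔ r e₂ = i))
    {π : V → V'} (hπ : ∀ u v, π u = π v ↔ u = v ∨ (u = a ∧ v = c) ∨ (u = c ∧ v = a)) :
    ∃ l' r' : E → Option ι, IsAbstractDual (π ∘ s) (π ∘ t) l' r' := by
  classical
  set χ : E → ZMod 2 := fun e => if e = e₁ ∨ e = e₂ then 1 else 0 with hχ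
  have hχsum : ∀ τ : V → ZMod 2, ∑ e, χ e * (τ (s e) + τ (t e)) = τ a + τ c := by
    intro τ
    rw [sum_ite_eq_add_ite_eq hne (fun e => τ (s e) + τ (t e)), add_ends_eq h₁, add_ends_eq h₂]
    generalize τ a = x, τ c = y, τ d = z
    revert x y z
    decide
  have hδ : ∀ (σ : Option ι → ZMod 2) (e : E),
      σ (if (e = e₁ ∨ e = e₂) ∧ l e = i then none else some (l e)) +
        σ (if (e = e₁ ∨ e = e₂) ∧ r e = i then none else some (r e)) =
      σ (some (l e)) + σ (some (r e)) + (σ none + σ (some i)) * χ e := by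
    intro σ e
    by_cases he : e = e₁ ∨ e = e₂
    · have hie : ¬ (l e = i ↔ r e = i) := by rcases he with rfl | rfl <;> assumption
      simp only [he, hχ, true_and, if_true, mul_one]
      by_cases hl : l e = i <;> by_cases hr : r e = i
      · tauto
      · simp only [hl, hr, if_true, if_false]
        generalize σ none = x, σ (some i) = y, σ (some (r e)) = z
        revert x y z
        decide
      · simp only [hl, hr, if_true, if_false]
        generalize σ none = x, σ (some i) = y, σ (some (l e)) = z
        revert x y z
        decide
      · tauto
    · simp [he, hχ]
  refine ⟨fun e => if (e = e₁ ∨ e = e₂) ∧ l e = i then none else some (l e),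
    fun e => if (e = e₁ ∨ e = e₂) ∧ r e = i then none else some (r e), fun z => ?_⟩
  simp only [hδ]
  constructor
  · intro hz
    have hz' : ∀ τ : V → ZMod 2, τ a = τ c → ∑ e, z e * (τ (s e) + τ (t e)) = 0 := by
      intro τ hτ
      have hfac : Function.FactorsThrough τ π := by
        intro u v huv
        rcases (hπ u v).1 huv with rfl | ⟨rfl, rfl⟩ | ⟨rfl, rfl⟩
        exacts [rfl, hτ, hτ.symm]
      rw [← hz (Function.extend π τ 0)]
      simp only [Function.comp, hfac.extend_apply]
    set k : ZMod 2 := ∑ e, z e * ((Pi.single a 1 : V → ZMod 2) (s e) + (Pi.single a 1 : V → ZMod 2) (t e)) with hk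
    have hz2 : ∀ τ : V → ZMod 2,
        ∑ e, z e * (τ (s e) + τ (t e)) = k * (τ a + τ c) := by
      intro τ
      have := hz' (fun v => τ v + (τ a + τ c) * (Pi.single a 1 : V → ZMod 2) v) (by
        simp only [Pi.single_eq_same, Pi.single_eq_of_ne hac.symm]
        generalize τ a = x, τ c = y
        revert x y
        decide)
      rw [hk, Finset.sum_mul]
      rw [← sub_eq_zero, ← Finset.sum_sub_distrib, ← this]
      refine Finset.sum_congr rfl fun e _ => ?_
      rw [CharTwo.sub_eq_add]
      ring
    obtain ⟨σ, hσ⟩ := (h fun e => z e + k * χ e).1 fun τ => by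
      have : ∀ e, (z e + k * χ e) * (τ (s e) + τ (t e)) =
        z e * (τ (s e) + τ (t e)) + k * (χ e * (τ (s e) + τ (t e))) := fun e => by ring
      simp only [this, Finset.sum_add_distrib, ← Finset.mul_sum, hχsum, hz2]
      exact CharTwo.add_self_eq_zero _
    refine ⟨fun o => o.elim (σ i + k) σ, fun e => ?_⟩
    simp only [Option.elim_none, Option.elim_some, ← hσ e]
    generalize z e = x, σ i = y, χ e = w, k = k
    revert x y w k
    decide
  · rintro ⟨σ, hσ⟩ τ
    have h0 := (h fun e => σ (some (l e)) + σ (some (r e))).2 ⟨fun i => σ (some i), fun _ => rfl⟩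
      (τ ∘ π)
    have h1 := hχsum (τ ∘ π)
    have hac' : π a = π c := (hπ a c).2 (by simp)
    simp only [hσ, add_mul, mul_assoc, Finset.sum_add_distrib, ← Finset.mul_sum]
    simp only [Function.comp, hac', CharTwo.add_self_eq_zero] at h0 h1 ⊢
    simp only [add_mul, Finset.sum_add_distrib] at h0
    rw [h0, h1]
    simp

lemma product_coboundary : ∀ x x' y y' : ZMod 2,
    (x + x' = 0 → y + y' = 0 → x * y + x' * y' = 0) ∧
    (x = 0 → y = 0 → x + x' = 1 → y + y' = 1 → x * y + x' * y' = 1) ∧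
    (x' = 0 → y' = 0 → x + x' = 1 → y + y' = 1 → x * y + x' * y' = 1) ∧
    (x = 0 → x + x' = 0 → x * y + x' * y' = 0) ∧
    (y = 0 → y + y' = 0 → x * y + x' * y' = 0) ∧
    (x' = 0 → x + x' = 0 → x * y + x' * y' = 0) ∧
    (y' = 0 → y + y' = 0 → x * y + x' * y' = 0) := by
  intro x x' y y'
  refine ⟨?_, ?_, ?_, ?_, ?_, ?_, ?_⟩ <;> revert x x' y y' <;> decide

/-- Two disjoint paths cannot join the two pairs of opposite corners of a four-sided face. -/
lemma not_crossing [Fintype E] {s t : E → V} {l r : E → ι} (h : IsAbstractDual s t l r)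
    {a b c d : V} (hac : a ≠ c) (hbd : b ≠ d) {e₁ e₂ e₃ : E} (h₁ : s(s e₁, t e₁) = s(a, b))
    (h₂ : s(s e₂, t e₂) = s(b, c)) (h₃ : s(s e₃, t e₃) = s(c, d)) {i : ι}
    (hi₁ : l e₁ = i ∨ r e₁ = i) (hi₂ : l e₂ = i ∨ r e₂ = i) (hi₃ : l e₃ = i ∨ r e₃ = i)
    {S : Set V} (ha : a ∈ S) (hb : b ∉ S) (hc : c ∈ S) (hd : d ∉ S) {p q : E → ZMod 2}
    (hp : ∀ τ : V → ZMod 2, ∑ e, p e * (τ (s e) + τ (t e)) = τ a + τ c)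
    (hq : ∀ τ : V → ZMod 2, ∑ e, q e * (τ (s e) + τ (t e)) = τ b + τ d)
    (hpS : ∀ e, p e ≠ 0 → s e ∈ S ∧ t e ∈ S) (hqS : ∀ e, q e ≠ 0 → s e ∉ S ∧ t e ∉ S) :
    False := by
  classical
  have h12 : e₁ ≠ e₂ := by
    rintro rfl
    rcases Sym2.eq_iff.1 (h₁.symm.trans h₂) with ⟨h1, -⟩ | ⟨h1, -⟩
    exacts [hb (h1 ▸ ha), hac h1]
  have h23 : e₂ ≠ e₃ := by
    rintro rfl
    rcases Sym2.eq_iff.1 (h₂.symm.trans h₃) with ⟨h1, -⟩ | ⟨h1, -⟩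
    exacts [hb (h1 ▸ hc), hbd h1]
  have h13 : e₁ ≠ e₃ := by
    rintro rfl
    rcases Sym2.eq_iff.1 (h₁.symm.trans h₃) with ⟨h1, -⟩ | ⟨h1, -⟩
    exacts [hac h1, hd (h1 ▸ ha)]
  have normalize : ∀ z : E → ZMod 2, (∀ τ : V → ZMod 2, ∑ e, z e * (τ (s e) + τ (t e)) = 0) →
      ∃ σ : ι → ZMod 2, σ i = 0 ∧ ∀ e, z e = σ (l e) + σ (r e) := by
    intro z hz
    obtain ⟨σ, hσ⟩ := (h z).1 hz
    refine ⟨fun j => σ j + σ i, CharTwo.add_self_eq_zero _, fun e => ?_⟩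
    rw [hσ]
    dsimp only
    generalize σ (l e) = x, σ (r e) = y, σ i = w
    revert x y w
    decide
  obtain ⟨σ, hσi, hσ⟩ := normalize (fun e => p e + if e = e₁ ∨ e = e₂ then 1 else 0) fun τ => by
    simp only [add_mul, Finset.sum_add_distrib, hp]
    rw [sum_ite_eq_add_ite_eq h12 (fun e => τ (s e) + τ (t e)), add_ends_eq h₁, add_ends_eq h₂]
    generalize τ a = x, τ b = y, τ c = z
    revert x y z
    decide
  obtain ⟨ρ, hρi, hρ⟩ := normalize (fun e => q e + if e = e₂ ∨ e = e₃ then 1 else 0) fun τ => by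
    simp only [add_mul, Finset.sum_add_distrib, hq]
    rw [sum_ite_eq_add_ite_eq h23 (fun e => τ (s e) + τ (t e)), add_ends_eq h₂, add_ends_eq h₃]
    generalize τ b = x, τ c = y, τ d = z
    revert x y z
    decide
  have hsum := (h fun e => σ (l e) * ρ (l e) + σ (r e) * ρ (r e)).2
    ⟨fun j => σ j * ρ j, fun _ => rfl⟩ (S.indicator 1)
  have hterm : ∀ e, (σ (l e) * ρ (l e) + σ (r e) * ρ (r e)) *
      (S.indicator (1 : V → ZMod 2) (s e) + S.indicator 1 (t e)) = if e = e₂ then 1 else 0 := by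
    intro e
    by_cases hsame : s e ∈ S ↔ t e ∈ S
    · have he : e ≠ e₂ := by
        rintro rfl
        rcases Sym2.eq_iff.1 h₂ with ⟨h1, h2⟩ | ⟨h1, h2⟩ <;> rw [h1, h2] at hsame <;> tauto
      by_cases hs : s e ∈ S
      · simp [Set.indicator, hs, hsame.1 hs, he, CharTwo.add_self_eq_zero]
      · have ht : t e ∉ S := fun hh => hs (hsame.2 hh)
        simp [Set.indicator, hs, ht, he]
    · have hone : S.indicator (1 : V → ZMod 2) (s e) + S.indicator 1 (t e) = 1 := by
        by_cases hs : s e ∈ S <;> by_cases ht : t e ∈ S <;> simp [Set.indicator, hs, ht] <;> tauto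
      have hpe : p e = 0 := by
        by_contra hne
        have := hpS e hne
        tauto
      have hqe : q e = 0 := by
        by_contra hne
        have := hqS e hne
        tauto
      have hσe := hσ e
      have hρe := hρ e
      rw [hone, mul_one]
      rw [hpe, zero_add] at hσe
      rw [hqe, zero_add] at hρe
      obtain ⟨f1, f2, f3, f4, f5, f6, f7⟩ :=
        product_coboundary (σ (l e)) (σ (r e)) (ρ (l e)) (ρ (r e))
      by_cases he2 : e = e₂
      · subst he2
        simp only [if_true, or_true, true_or] at hσe hρe ⊢
        rcases hi₂ with hi | hi
        · exact f2 (hi ▸ hσi) (hi ▸ hρi) hσe.symm hρe.symm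
        · exact f3 (hi ▸ hσi) (hi ▸ hρi) hσe.symm hρe.symm
      · by_cases he1 : e = e₁
        · subst he1
          simp only [he2, h13, or_self, if_false] at hρe ⊢
          rcases hi₁ with hi | hi
          · exact f5 (hi ▸ hρi) hρe.symm
          · exact f7 (hi ▸ hρi) hρe.symm
        · simp only [he1, he2, or_self, if_false] at hσe ⊢
          by_cases he3 : e = e₃
          · subst he3
            rcases hi₃ with hi | hi
            · exact f4 (hi ▸ hσi) hσe.symm
            · exact f6 (hi ▸ hσi) hσe.symm
          · simp only [he2, he3, or_self, if_false] at hρe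
            exact f1 hσe.symm hρe.symm
  simp only [hterm, Finset.sum_ite_eq', Finset.mem_univ, if_true] at hsum
  exact one_ne_zero hsum

end IsAbstractDual

end Duality

section DualPlanar

variable {V' : Type u}

namespace IsAbstractDual

variable {E : Type*} {ι : Type w}

lemma exists_next [Fintype E] {s t : E → V} (hloop : ∀ e, s e ≠ t e) {z : E → ZMod 2}
    (hz : ∀ τ : V → ZMod 2, ∑ e, z e * (τ (s e) + τ (t e)) = 0) {e : E} (he : z e ≠ 0) {x y : V}
    (hxy : s(s e, t e) = s(x, y)) : ∃ e' ≠ e, z e' ≠ 0 ∧ ∃ w ≠ y, s(s e', t e') = s(y, w) := by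
  classical
  by_contra! hcon
  have hsum := hz (Pi.single y 1)
  rw [Finset.sum_eq_single e, add_ends_eq hxy] at hsum
  · have hne : x ≠ y := by
      rintro rfl
      apply hloop e
      rcases Sym2.eq_iff.1 hxy with ⟨h1, h2⟩ | ⟨h1, h2⟩ <;> rw [h1, h2]
    simp [hne, he] at hsum
  · intro e' _ hne
    by_cases hz' : z e' = 0
    · simp [hz']
    have h1 : s e' ≠ y := fun h => hcon e' hne hz' (t e') (fun h' => hloop e' (h.trans h'.symm))
      (by rw [h])
    have h2 : t e' ≠ y := fun h => hcon e' hne hz' (s e') (fun h' => hloop e' (h'.trans h.symm))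
      (by rw [h, Sym2.eq_swap])
    simp [h1, h2]
  · simp

/-- In a simple triangle-free graph, a non-empty cycle with at most four edges is a four-cycle. -/
lemma exists_fourCycle [Fintype E] {s t : E → V} (hloop : ∀ e, s e ≠ t e)
    (hinj : ∀ e e', s(s e, t e) = s(s e', t e') → e = e')
    (htri : ∀ e₁ e₂ e₃ a b c, s(s e₁, t e₁) = s(a, b) → s(s e₂, t e₂) = s(b, c) →
      s(s e₃, t e₃) ≠ s(c, a)) {z : E → ZMod 2}
    (hz : ∀ τ : V → ZMod 2, ∑ e, z e * (τ (s e) + τ (t e)) = 0) (hne : ∃ e, z e ≠ 0)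
    (hcard : (Finset.univ.filter fun e => z e ≠ 0).card ≤ 4) :
    ∃ a b c d e₁ e₂ e₃ e₄, a ≠ c ∧ b ≠ d ∧ z e₁ ≠ 0 ∧ z e₂ ≠ 0 ∧ z e₃ ≠ 0 ∧ z e₄ ≠ 0 ∧
      s(s e₁, t e₁) = s(a, b) ∧ s(s e₂, t e₂) = s(b, c) ∧ s(s e₃, t e₃) = s(c, d) ∧
      s(s e₄, t e₄) = s(d, a) := by
  classical
  obtain ⟨e₁, hz₁⟩ := hne
  obtain ⟨a, b, h₁⟩ : ∃ a b, s(s e₁, t e₁) = s(a, b) := ⟨_, _, rfl⟩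
  obtain ⟨e₂, n₁₂, hz₂, c, hcb, h₂⟩ := exists_next hloop hz hz₁ h₁
  obtain ⟨e₃, n₂₃, hz₃, d, hdc, h₃⟩ := exists_next hloop hz hz₂ h₂
  obtain ⟨e₄, n₃₄, hz₄, x, hxd, h₄⟩ := exists_next hloop hz hz₃ h₃
  have hab : a ≠ b := by
    rintro rfl
    apply hloop e₁
    rcases Sym2.eq_iff.1 h₁ with ⟨h1, h2⟩ | ⟨h1, h2⟩ <;> rw [h1, h2]
  have hca : a ≠ c := by
    rintro rfl
    exact n₁₂ (hinj _ _ (by rw [h₂, h₁, Sym2.eq_swap]))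
  have hdb : b ≠ d := by
    rintro rfl
    exact n₂₃ (hinj _ _ (by rw [h₃, h₂, Sym2.eq_swap]))
  have hxc : x ≠ c := by
    rintro rfl
    exact n₃₄ (hinj _ _ (by rw [h₄, h₃, Sym2.eq_swap]))
  have hda : d ≠ a := by
    rintro rfl
    exact htri _ _ _ _ _ _ h₁ h₂ h₃
  have hxb : x ≠ b := by
    rintro rfl
    exact htri _ _ _ _ _ _ h₂ h₃ h₄
  by_cases hxa : x = a
  · subst hxa
    exact ⟨x, b, c, d, e₁, e₂, e₃, e₄, hca, hdb, hz₁, hz₂, hz₃, hz₄, h₁, h₂, h₃, h₄⟩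
  obtain ⟨e₅, n₄₅, hz₅, y, hyx, h₅⟩ := exists_next hloop hz hz₄ h₄
  exfalso
  have key : ∀ {e e' p q p' q'}, s(s e, t e) = s(p, q) → s(s e', t e') = s(p', q') → e = e' →
      (p = p' ∧ q = q') ∨ (p = q' ∧ q = p') := by
    rintro e _ p q p' q' h h' rfl
    exact Sym2.eq_iff.1 (h.symm.trans h')
  have m13 : e₁ ≠ e₃ := fun h => by have := key h₁ h₃ h; grind
  have m14 : e₁ ≠ e₄ := fun h => by have := key h₁ h₄ h; grind
  have m15 : e₁ ≠ e₅ := fun h => by have := key h₁ h₅ h; grind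
  have m24 : e₂ ≠ e₄ := fun h => by have := key h₂ h₄ h; grind
  have m25 : e₂ ≠ e₅ := fun h => by have := key h₂ h₅ h; grind
  have m35 : e₃ ≠ e₅ := fun h => by have := key h₃ h₅ h; grind
  have hsub : ({e₁, e₂, e₃, e₄, e₅} : Finset E) ⊆ Finset.univ.filter fun e => z e ≠ 0 := by
    intro e he
    simp only [Finset.mem_insert, Finset.mem_singleton] at he
    rw [Finset.mem_filter]
    rcases he with rfl | rfl | rfl | rfl | rfl
    exacts [⟨Finset.mem_univ _, hz₁⟩, ⟨Finset.mem_univ _, hz₂⟩, ⟨Finset.mem_univ _, hz₃⟩,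
      ⟨Finset.mem_univ _, hz₄⟩, ⟨Finset.mem_univ _, hz₅⟩]
  have h5 : ({e₁, e₂, e₃, e₄, e₅} : Finset E).card = 5 := by
    rw [Finset.card_insert_of_notMem, Finset.card_insert_of_notMem, Finset.card_insert_of_notMem,
      Finset.card_pair n₄₅.symm] <;> simp only [Finset.mem_insert, Finset.mem_singleton, not_or]
    exacts [⟨n₃₄.symm, m35⟩, ⟨n₂₃.symm, m24, m25⟩, ⟨n₁₂.symm, m13, m14, m15⟩]
  have := Finset.card_le_card hsub
  omega

lemma card_le_of_cycleSpace [Fintype E] [Fintype V] [Nonempty V] {s t : E → V}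
    {Z : Submodule (ZMod 2) (E → ZMod 2)}
    (hZ : ∀ z : E → ZMod 2, (∀ τ : V → ZMod 2, ∑ e, z e * (τ (s e) + τ (t e)) = 0) → z ∈ Z) :
    Fintype.card E + 1 ≤ Fintype.card V + Module.finrank (ZMod 2) Z := by
  classical
  let D : (E → ZMod 2) →ₗ[ZMod 2] (V → ZMod 2) :=
    { toFun := fun z v => ∑ e, z e * ((Pi.single v 1 : V → ZMod 2) (s e) +
        (Pi.single v 1 : V → ZMod 2) (t e))
      map_add' := fun x y => by ext v; simp [add_mul, Finset.sum_add_distrib]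
      map_smul' := fun a x => by ext v; simp [mul_assoc, Finset.mul_sum] }
  let ε : (V → ZMod 2) →ₗ[ZMod 2] ZMod 2 := ∑ v, LinearMap.proj v
  have hε : ∀ x, ε x = ∑ v, x v := fun x => by simp [ε, LinearMap.sum_apply]
  have hpair : ∀ (z : E → ZMod 2) (τ : V → ZMod 2),
      ∑ e, z e * (τ (s e) + τ (t e)) = ∑ v, τ v * D z v := by
    intro z τ
    change _ = ∑ v, τ v * ∑ e, z e * ((Pi.single v 1 : V → ZMod 2) (s e) +
        (Pi.single v 1 : V → ZMod 2) (t e))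
    simp only [Finset.mul_sum]
    rw [Finset.sum_comm]
    refine Finset.sum_congr rfl fun e _ => ?_
    have : ∀ v, τ v * (z e * ((Pi.single v 1 : V → ZMod 2) (s e) +
        (Pi.single v 1 : V → ZMod 2) (t e))) =
        z e * ((if s e = v then τ v else 0) + if t e = v then τ v else 0) := by
      intro v
      simp only [Pi.single_apply]
      split_ifs <;> ring
    simp only [this, ← Finset.mul_sum, Finset.sum_add_distrib]
    simp
  have hker : LinearMap.ker D ≤ Z := by
    intro z hz
    refine hZ z fun τ => ?_
    rw [hpair, LinearMap.mem_ker.1 hz]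
    simp
  have hrange : LinearMap.range D ≤ LinearMap.ker ε := by
    rintro _ ⟨z, rfl⟩
    rw [LinearMap.mem_ker, hε]
    have := hpair z 1
    simp only [Pi.one_apply, one_mul, CharTwo.add_self_eq_zero, mul_zero,
      Finset.sum_const_zero] at this
    exact this.symm
  have hsurj : Function.Surjective ε := by
    intro x
    obtain ⟨v⟩ := ‹Nonempty V›
    exact ⟨Pi.single v x, by rw [hε]; simp⟩
  have h1 := LinearMap.finrank_range_add_finrank_ker D
  have h2 := LinearMap.finrank_range_add_finrank_ker ε
  rw [LinearMap.range_eq_top.2 hsurj, finrank_top] at h2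
  have h3 := Submodule.finrank_mono hker
  have h4 := Submodule.finrank_mono hrange
  simp only [Module.finrank_fintype_fun_eq_card, Module.finrank_self] at h1 h2
  omega

/-- Euler's inequality for a graph all of whose faces are empty or have length at least five. -/
lemma euler [Fintype E] [Fintype V] [Nonempty V] {s t : E → V} {l r : E → ι}
    (h : IsAbstractDual s t l r)
    (hface : ∀ k, (∃ e, ¬ (l e = k ↔ r e = k)) → ∃ A : Finset E, 5 ≤ A.card ∧
      ∀ e ∈ A, ¬ (l e = k ↔ r e = k)) :
    3 * Fintype.card E + 10 ≤ 5 * Fintype.card V ∨ Fintype.card E + 1 ≤ Fintype.card V := by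
  classical
  set F : Finset ι := (Finset.univ.image l ∪ Finset.univ.image r).filter
    fun k => ∃ e, ¬ (l e = k ↔ r e = k) with hF
  have hFmem : ∀ k e, ¬ (l e = k ↔ r e = k) → k ∈ F := by
    intro k e he
    simp only [hF, Finset.mem_filter, Finset.mem_union, Finset.mem_image, Finset.mem_univ,
      true_and]
    refine ⟨?_, e, he⟩
    by_cases hl : l e = k
    · exact Or.inl ⟨e, hl⟩
    · exact Or.inr ⟨e, by tauto⟩
  let B : (F → ZMod 2) →ₗ[ZMod 2] (E → ZMod 2) :=
    { toFun := fun σ e => ∑ k : F, σ k * (if l e = k ↔ r e = k then 0 else 1)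
      map_add' := fun x y => by
        ext v; simp only [Pi.add_apply, add_mul, Finset.sum_add_distrib]
      map_smul' := fun a x => by ext v; simp only [smul_eq_mul, Pi.smul_apply, mul_assoc,
        Finset.mul_sum, RingHom.id_apply] }
  have hB : ∀ (σ : ι → ZMod 2) e, B (fun k => σ k) e = σ (l e) + σ (r e) := by
    intro σ e
    change ∑ k : F, σ k * (if l e = k ↔ r e = k then 0 else 1) = _
    rw [Finset.sum_coe_sort F fun k => σ k * (if l e = k ↔ r e = k then (0 : ZMod 2) else 1)]
    by_cases hlr : l e = r e
    · rw [hlr, CharTwo.add_self_eq_zero]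
      exact Finset.sum_eq_zero fun k _ => by simp
    · rw [← Finset.sum_subset (s₁ := {l e, r e}), Finset.sum_pair hlr]
      · simp [hlr, Ne.symm hlr]
      · intro k hk
        simp only [Finset.mem_insert, Finset.mem_singleton] at hk
        refine hFmem k e ?_
        rcases hk with rfl | rfl <;> grind
      · intro k _ hk
        simp only [Finset.mem_insert, Finset.mem_singleton] at hk
        rw [if_pos (by grind), mul_zero]
  have hcard := card_le_of_cycleSpace (s := s) (t := t) (Z := LinearMap.range B) fun z hz => by
    obtain ⟨σ, hσ⟩ := (h z).1 hz
    exact ⟨fun k => σ k, funext fun e => by rw [hB, hσ]⟩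
  have hrank := LinearMap.finrank_range_add_finrank_ker B
  simp only [Module.finrank_fintype_fun_eq_card, Fintype.card_coe] at hrank
  rcases F.eq_empty_or_nonempty with hemp | hne
  · right
    have h0 : F.card = 0 := by rw [hemp, Finset.card_empty]
    omega
  left
  have hkerpos : 0 < Module.finrank (ZMod 2) (LinearMap.ker B) := by
    rw [Module.finrank_pos_iff, Submodule.nontrivial_iff_ne_bot, Submodule.ne_bot_iff]
    refine ⟨fun _ => 1, ?_, fun h0 => ?_⟩
    · rw [LinearMap.mem_ker]
      ext e
      rw [hB fun _ => 1]
      exact CharTwo.add_self_eq_zero _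
    · obtain ⟨k, hk⟩ := hne
      exact one_ne_zero (congrFun h0 ⟨k, hk⟩)
  have hdouble : 5 * F.card ≤ 2 * Fintype.card E := by
    have h1 : ∀ k ∈ F, 5 ≤ (Finset.univ.filter fun e => ¬ (l e = k ↔ r e = k)).card := by
      intro k hk
      obtain ⟨A, hA, hA'⟩ := hface k (Finset.mem_filter.1 hk).2
      exact hA.trans (Finset.card_le_card fun e he => by simpa using hA' e he)
    have h2 : ∀ e ∈ (Finset.univ : Finset E), (F.filter fun k => ¬ (l e = k ↔ r e = k)).card ≤ 2 := by
      intro e _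
      refine (Finset.card_le_card (t := {l e, r e}) fun k hk => ?_).trans Finset.card_le_two
      have := (Finset.mem_filter.1 hk).2
      simp only [Finset.mem_insert, Finset.mem_singleton]
      grind
    have h3 := Finset.sum_card_bipartiteAbove_eq_sum_card_bipartiteBelow (s := F)
      (t := (Finset.univ : Finset E)) fun k e => ¬ (l e = k ↔ r e = k)
    have h4 := Finset.sum_le_sum h1
    have h5 := Finset.sum_le_sum h2
    simp only [Finset.sum_const, smul_eq_mul, Finset.card_univ] at h4 h5
    simp only [Finset.bipartiteAbove, Finset.bipartiteBelow] at h3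
    omega
  omega

end IsAbstractDual

end DualPlanar

section DualPlanarGraph

variable {V' : Type u}

/-- In a triangle-free graph, at most one of the two pairs of opposite corners of a four-sided face
is joined by a path of length three. -/
lemma IsAbstractDual.not_paths {E : Type*} {ι : Type w} [Fintype E] {s t : E → V} {l r : E → ι}
    (h : IsAbstractDual s t l r)
    {a b c d : V} (hac : a ≠ c) (hbd : b ≠ d) {e₁ e₂ e₃ : E} (h₁ : s(s e₁, t e₁) = s(a, b))
    (h₂ : s(s e₂, t e₂) = s(b, c)) (h₃ : s(s e₃, t e₃) = s(c, d)) {i : ι}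
    (hi₁ : l e₁ = i ∨ r e₁ = i) (hi₂ : l e₂ = i ∨ r e₂ = i) (hi₃ : l e₃ = i ∨ r e₃ = i)
    {x y z w : V} {f₁ f₂ f₃ g₁ g₂ g₃ : E} (hf₁ : s(s f₁, t f₁) = s(a, x))
    (hf₂ : s(s f₂, t f₂) = s(x, y)) (hf₃ : s(s f₃, t f₃) = s(y, c))
    (hg₁ : s(s g₁, t g₁) = s(b, z)) (hg₂ : s(s g₂, t g₂) = s(z, w))
    (hg₃ : s(s g₃, t g₃) = s(w, d)) (hb : b ∉ ({a, x, y, c} : Set V))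
    (hd : d ∉ ({a, x, y, c} : Set V)) (hz : z ∉ ({a, x, y, c} : Set V))
    (hw : w ∉ ({a, x, y, c} : Set V)) : False := by
  classical
  have hsum : ∀ (k₁ k₂ k₃ : E) (g : E → ZMod 2),
      ∑ e, ((if e = k₁ then 1 else 0) + (if e = k₂ then 1 else 0) + (if e = k₃ then 1 else 0)) * g e
        = g k₁ + g k₂ + g k₃ := by
    intro k₁ k₂ k₃ g
    simp [add_mul, Finset.sum_add_distrib]
  have hends : ∀ {e p q} (P : V → Prop), s(s e, t e) = s(p, q) → P p → P q → P (s e) ∧ P (t e) := by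
    intro e p q P he hp hq
    rcases Sym2.eq_iff.1 he with ⟨h1, h2⟩ | ⟨h1, h2⟩ <;> rw [h1, h2] <;> tauto
  have hsupp : ∀ {k₁ k₂ k₃ e : E}, (if e = k₁ then (1 : ZMod 2) else 0) +
      (if e = k₂ then 1 else 0) + (if e = k₃ then 1 else 0) ≠ 0 → e = k₁ ∨ e = k₂ ∨ e = k₃ := by
    intro k₁ k₂ k₃ e he
    by_contra hcon
    rw [not_or, not_or] at hcon
    rw [if_neg hcon.1, if_neg hcon.2.1, if_neg hcon.2.2] at he
    simp at he
  have hpath : ∀ {k₁ k₂ k₃ : E} {p q v u : V}, s(s k₁, t k₁) = s(p, q) → s(s k₂, t k₂) = s(q, v) →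
      s(s k₃, t k₃) = s(v, u) → ∀ τ : V → ZMod 2, ∑ e, ((if e = k₁ then 1 else 0) +
        (if e = k₂ then 1 else 0) + (if e = k₃ then 1 else 0)) * (τ (s e) + τ (t e)) =
        τ p + τ u := by
    intro k₁ k₂ k₃ p q v u hk₁ hk₂ hk₃ τ
    rw [hsum k₁ k₂ k₃ fun e => τ (s e) + τ (t e), add_ends_eq hk₁, add_ends_eq hk₂,
      add_ends_eq hk₃]
    linear_combination CharTwo.add_self_eq_zero (τ q) + CharTwo.add_self_eq_zero (τ v)
  refine h.not_crossing hac hbd h₁ h₂ h₃ hi₁ hi₂ hi₃ (S := {a, x, y, c}) (by simp) hb (by simp) hd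
    (hpath hf₁ hf₂ hf₃) (hpath hg₁ hg₂ hg₃) (fun e he => ?_) fun e he => ?_
  · rcases hsupp he with rfl | rfl | rfl
    · exact hends (· ∈ ({a, x, y, c} : Set V)) hf₁ (by simp) (by simp)
    · exact hends (· ∈ ({a, x, y, c} : Set V)) hf₂ (by simp) (by simp)
    · exact hends (· ∈ ({a, x, y, c} : Set V)) hf₃ (by simp) (by simp)
  · rcases hsupp he with rfl | rfl | rfl
    · exact hends (· ∉ ({a, x, y, c} : Set V)) hg₁ hb hz
    · exact hends (· ∉ ({a, x, y, c} : Set V)) hg₂ hz hw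
    · exact hends (· ∉ ({a, x, y, c} : Set V)) hg₃ hw hd

namespace SimpleGraph

/-- A combinatorial form of planarity: the graph is spanned by a multigraph with an abstract
dual. -/
def DualPlanar (G : SimpleGraph V) : Prop :=
  ∃ (E : Type u) (_ : Fintype E) (ι : Type) (s t : E → V) (l r : E → ι),
    IsAbstractDual s t l r ∧ ∀ u v, G.Adj u v → ∃ e, s(s e, t e) = s(u, v)

lemma DualPlanar.exists_dual {G : SimpleGraph V} (h : G.DualPlanar) {G' : SimpleGraph V'}
    [Fintype G'.edgeSet] {φ : V' → V} (hφ : φ.Injective)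
    (hadj : ∀ u v, G'.Adj u v → G.Adj (φ u) (φ v)) :
    ∃ (ι : Type) (s t : G'.edgeSet → V') (l r : G'.edgeSet → ι),
      (∀ e, s(s e, t e) = e.1) ∧ IsAbstractDual s t l r := by
  obtain ⟨E, _, ι, s, t, l, r, hdual, hE⟩ := h
  have hends : ∀ e : G'.edgeSet, ∃ u v, s(u, v) = e.1 := fun ⟨e, _⟩ => by
    induction e with
    | h x y => exact ⟨x, y, rfl⟩
  choose s' t' hst using hends
  have hadj' : ∀ e : G'.edgeSet, G'.Adj (s' e) (t' e) := fun e => by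
    rw [← mem_edgeSet, hst]
    exact e.2
  choose f hf using fun e => hE _ _ (hadj _ _ (hadj' e))
  have hfinj : f.Injective := fun e e' hee => by
    have := (hf e).symm.trans ((congrArg (fun e => s(s e, t e)) hee).trans (hf e'))
    rw [← Sym2.map_mk, ← Sym2.map_mk] at this
    rw [Subtype.ext_iff, ← hst, ← hst]
    exact Sym2.map.injective hφ this
  obtain ⟨ι', l', r', hd⟩ := hdual.minor ∅ hfinj (fun _ => Set.notMem_empty _) (s' := s')
    (t' := t') fun y => by
      simp only [Set.mem_empty_iff_false, false_imp_iff, implies_true, true_and,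
        fun (τ : V → ZMod 2) e => IsAbstractDual.add_ends_eq (hf e) τ]
      constructor
      · rintro ⟨τ, hτ⟩
        exact ⟨τ ∘ φ, hτ⟩
      · rintro ⟨τ, hτ⟩
        exact ⟨Function.extend φ τ 0, by simpa only [hφ.extend_apply] using hτ⟩
  exact ⟨ι', s', t', l', r', hst, hd⟩

lemma DualPlanar.induce {G : SimpleGraph V} [Finite V] (h : G.DualPlanar) (A : Set V) :
    (G.induce A).DualPlanar := by
  have := Fintype.ofFinite (G.induce A).edgeSet
  obtain ⟨ι, s, t, l, r, hst, hd⟩ := h.exists_dual (G' := G.induce A) (φ := Subtype.val)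
    Subtype.val_injective fun u v huv => huv
  exact ⟨_, _, ι, s, t, l, r, hd, fun u v huv => ⟨⟨s(u, v), huv⟩, hst _⟩⟩

/-- The graph obtained by identifying vertices along `π`. -/
def identify (G : SimpleGraph V) (π : V → V') : SimpleGraph V' :=
  SimpleGraph.fromRel fun p q => ∃ u v, G.Adj u v ∧ π u = p ∧ π v = q

lemma identify_adj {G : SimpleGraph V} {π : V → V'} {p q : V'} :
    (G.identify π).Adj p q ↔ p ≠ q ∧ ∃ u v, G.Adj u v ∧ π u = p ∧ π v = q := by
  rw [identify, fromRel_adj]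
  refine and_congr_right fun _ => or_iff_left_of_imp ?_
  rintro ⟨u, v, huv, hu, hv⟩
  exact ⟨v, u, huv.symm, hv, hu⟩

/-- Identifying two non-adjacent vertices that are not joined by a path of length three creates no
triangle. -/
lemma CliqueFree.identify {G : SimpleGraph V} (hG : G.CliqueFree 3) {a c : V} {π : V → V'}
    (hπ : ∀ u v, π u = π v ↔ u = v ∨ (u = a ∧ v = c) ∨ (u = c ∧ v = a))
    (hpath : ∀ x y, G.Adj a x → G.Adj x y → ¬ G.Adj y c) : (G.identify π).CliqueFree 3 := by
  classical
  have htri : ∀ x y z, G.Adj x y → G.Adj y z → ¬ G.Adj z x := fun x y z hxy hyz hzx =>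
    hG {x, y, z} (is3Clique_triple_iff.2 ⟨hxy, hzx.symm, hyz⟩)
  intro S hS
  obtain ⟨p, q, r, hpq, hpr, hqr, -⟩ := is3Clique_iff.1 hS
  obtain ⟨n₁, u₁, v₁, h₁, rfl, rfl⟩ := identify_adj.1 hpq
  obtain ⟨n₂, u₂, v₂, h₂, h₂u, rfl⟩ := identify_adj.1 hpr
  obtain ⟨n₃, u₃, v₃, h₃, h₃u, h₃v⟩ := identify_adj.1 hqr
  rw [hπ] at h₂u h₃u h₃v
  rw [ne_eq, hπ] at n₁ n₂ n₃
  have s₁ := h₁.symm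
  have s₂ := h₂.symm
  have s₃ := h₃.symm
  grind

end SimpleGraph

end DualPlanarGraph

section Coloring

namespace SimpleGraph

open scoped Classical in
lemma crossCount_univ (G : SimpleGraph V) [Fintype V] :
    G.crossCount Finset.univ Finset.univ = 2 * Fintype.card G.edgeSet := by
  rw [crossCount_eq_sum, ← edgeFinset_card]
  have := G.sum_degrees_eq_twice_card_edges
  simp only [← card_neighborFinset_eq_degree, neighborFinset_eq_filter] at this
  exact_mod_cast this

/-- The graph obtained by adding a new vertex adjacent to all vertices of `T`. -/
def apex (G : SimpleGraph V) (T : Finset V) : SimpleGraph (Option V) where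
  Adj p q := p.elim (q.elim False (· ∈ T)) fun u => q.elim (u ∈ T) (G.Adj u)
  symm := ⟨by
    rintro (_ | u) (_ | v) h
    exacts [h, h, h, h.symm]⟩
  loopless := ⟨by
    rintro (_ | u) h
    exacts [h, G.loopless.irrefl u h]⟩

lemma potential_apex_le (G : SimpleGraph V) [Fintype V] {T : Finset V} (hT : T.card ≤ 3)
    {S : Finset (Option V)} (hS : ∀ x, some x ∈ S) :
    10 * (Fintype.card V : ℤ) - 3 * G.crossCount Finset.univ Finset.univ - 8 ≤
      (G.apex T).potential S := by
  classical
  set P : Finset (Option V) := Finset.univ.map Function.Embedding.some with hP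
  have hPpot : (G.apex T).potential P =
      10 * (Fintype.card V : ℤ) - 3 * G.crossCount Finset.univ Finset.univ := by
    rw [potential, hP, Finset.card_map, Finset.card_univ]
    simp only [crossCount, Finset.sum_map]
    rfl
  have hnone : none ∉ P := by simp [hP]
  by_cases hn : none ∈ S
  · have hSP : (G.apex T).potential S =
        (G.apex T).potential P + 10 - 6 * (G.apex T).crossCount {none} P := by
      rw [← potential_insert _ hnone]
      congr 1
      ext (_ | x)
      · simp [hn]
      · simp [hP, hS]
    have hcross : (G.apex T).crossCount {none} P = T.card := by
      simp only [crossCount, hP, apex, Finset.sum_singleton, Finset.sum_map]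
      simp
    rw [hSP, hPpot, hcross]
    have : (T.card : ℤ) ≤ 3 := by exact_mod_cast hT
    linarith
  · have hSP : S = P := by
      ext (_ | x)
      · simp [hn, hnone]
      · simp [hP, hS]
    rw [hSP, hPpot]
    linarith

lemma disjoint_opposite_paths {G : SimpleGraph V}
    (htri : ∀ x y z, G.Adj x y → G.Adj y z → ¬ G.Adj z x) {a b c d x y z w : V}
    (hab : G.Adj a b) (hbc : G.Adj b c) (hcd : G.Adj c d) (hda : G.Adj d a)
    (hax : G.Adj a x) (hxy : G.Adj x y) (hyc : G.Adj y c) (hbz : G.Adj b z) (hzw : G.Adj z w)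
    (hwd : G.Adj w d) : b ∉ ({a, x, y, c} : Set V) ∧ d ∉ ({a, x, y, c} : Set V) ∧
      z ∉ ({a, x, y, c} : Set V) ∧ w ∉ ({a, x, y, c} : Set V) := by
  have key : ∀ {p q r}, G.Adj p q → G.Adj q r → G.Adj p r → False := fun h₁ h₂ h₃ =>
    htri _ _ _ h₁ h₂ h₃.symm
  refine ⟨?_, ?_, ?_, ?_⟩ <;> rintro (rfl | rfl | rfl | rfl)
  · exact hab.ne rfl
  · exact key hbc hyc.symm hxy
  · exact key hab hxy.symm hax
  · exact hbc.ne rfl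
  · exact hda.ne rfl
  · exact key hcd.symm hyc.symm hxy
  · exact key hda.symm hxy.symm hax
  · exact hcd.ne rfl
  · exact key hzw hwd hda.symm
  · exact key hab hbz hax
  · exact key hbc hyc.symm hbz
  · exact key hzw hwd hcd
  · exact key hab hbz hzw.symm
  · exact key hda hax hwd.symm
  · exact key hcd.symm hyc.symm hwd.symm
  · exact key hbc hzw.symm hbz

/-- A combinatorial form of the Jensen–Thomassen theorem, in a form suited to induction. -/
theorem DualPlanar.exists_coloring (n : ℕ) : ∀ {V : Type u} [Finite V] (G : SimpleGraph V),
    Nat.card V = n → G.DualPlanar → G.CliqueFree 3 → ∀ T : Finset V, T.card ≤ 3 →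
    ∃ (c : V → Fin 3) (k : Fin 3), (∀ u v, G.Adj u v → c u ≠ c v) ∧ ∀ x ∈ T, c x ≠ k := by
  induction n using Nat.strong_induction_on with
  | _ n ih =>
  intro V _ G hn hG hfree T hT
  classical
  have := Fintype.ofFinite V
  have htri : ∀ x y z, G.Adj x y → G.Adj y z → ¬ G.Adj z x := fun x y z hxy hyz hzx =>
    hfree {x, y, z} (is3Clique_triple_iff.2 ⟨hxy, hzx.symm, hyz⟩)
  by_cases hsmall : Fintype.card V ≤ 1
  · have := Fintype.card_le_one_iff_subsingleton.1 hsmall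
    exact ⟨fun _ => 0, 1, fun u v huv => absurd (Subsingleton.elim u v) huv.ne, by simp⟩
  have : Nonempty V := Fintype.card_pos_iff.1 (by omega)
  obtain ⟨ι, s, t, l, r, hst, hdual⟩ := hG.exists_dual (G' := G) (φ := id)
    Function.injective_id fun u v huv => huv
  have hadj : ∀ {e : G.edgeSet} {u v}, s(s e, t e) = s(u, v) → G.Adj u v := by
    intro e u v he
    rw [← mem_edgeSet, ← he, hst]
    exact e.2
  have hedge : ∀ {u v}, G.Adj u v → ∃ e, s(s e, t e) = s(u, v) := fun huv =>
    ⟨⟨s(_, _), huv⟩, hst _⟩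
  have step : ∀ (a c d : V) (e₁ e₂ : G.edgeSet) (i : ι), a ≠ c → s(s e₁, t e₁) = s(c, d) →
      s(s e₂, t e₂) = s(d, a) → ¬ (l e₁ = i ↔ r e₁ = i) → ¬ (l e₂ = i ↔ r e₂ = i) →
      (∀ x y, G.Adj a x → G.Adj x y → ¬ G.Adj y c) →
      ∃ (c : V → Fin 3) (k : Fin 3), (∀ u v, G.Adj u v → c u ≠ c v) ∧ ∀ x ∈ T, c x ≠ k := by
    intro a c d e₁ e₂ i hac h₁ h₂ hi₁ hi₂ hpath
    let π : V → {x // x ≠ c} := fun u => if h : u = c then ⟨a, hac⟩ else ⟨u, h⟩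
    have hπ : ∀ u v, π u = π v ↔ u = v ∨ (u = a ∧ v = c) ∨ (u = c ∧ v = a) := by
      intro u v
      by_cases hu : u = c <;> by_cases hv : v = c <;> simp [π, hu, hv] <;> grind
    have hne : e₁ ≠ e₂ := by
      rintro rfl
      rcases Sym2.eq_iff.1 (h₁.symm.trans h₂) with ⟨h1, h2⟩ | ⟨h1, h2⟩
      exacts [(hadj h₁).ne h1, hac h1.symm]
    obtain ⟨l', r', hd'⟩ := hdual.identify hac hne h₁ h₂ hi₁ hi₂ hπ
    have hproper : ∀ u v, G.Adj u v → π u ≠ π v := by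
      intro u v huv heq
      rcases (hπ u v).1 heq with rfl | ⟨rfl, rfl⟩ | ⟨rfl, rfl⟩
      · exact huv.ne rfl
      · exact htri _ _ _ (hadj h₁) (hadj h₂) huv
      · exact htri _ _ _ (hadj h₁) (hadj h₂) huv.symm
    have hcard : Nat.card {x // x ≠ c} < n := by
      rw [← hn]
      exact Finite.card_subtype_lt (x := c) (by simp)
    obtain ⟨f, k, hf, hk⟩ := ih _ hcard (G.identify π) rfl
      ⟨_, _, _, _, _, l', r', hd', fun p q hpq => by
        obtain ⟨-, u, v, huv, rfl, rfl⟩ := identify_adj.1 hpq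
        obtain ⟨e, he⟩ := hedge huv
        exact ⟨e, by simpa using congrArg (Sym2.map π) he⟩⟩
      (hfree.identify hπ hpath) (T.image π) (Finset.card_image_le.trans hT)
    exact ⟨f ∘ π, k, fun u v huv => hf _ _ (identify_adj.2 ⟨hproper u v huv, u, v, huv, rfl, rfl⟩),
      fun x hx => hk _ (Finset.mem_image_of_mem π hx)⟩
  by_cases hface : ∀ k, (∃ e, ¬ (l e = k ↔ r e = k)) → ∃ A : Finset G.edgeSet, 5 ≤ A.card ∧
      ∀ e ∈ A, ¬ (l e = k ↔ r e = k)
  · have heuler := hdual.euler hface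
    by_cases hcol : (G.apex T).ColorableOn Finset.univ
    · obtain ⟨c, hc⟩ := hcol
      exact ⟨fun x => c (some x), c none, fun u v huv => hc _ (Finset.mem_univ _) _
        (Finset.mem_univ _) huv, fun x hx => hc (some x) (Finset.mem_univ _) none
        (Finset.mem_univ _) hx⟩
    obtain ⟨S, -, hpot, hS⟩ := exists_potential_le_of_not_colorableOn _ _ hcol
    by_cases hall : ∀ x, some x ∈ S
    · have h1 := G.potential_apex_le hT hall
      rw [crossCount_univ] at h1
      zify at heuler hsmall
      have h2 : Fintype.card (G.edgeSet) = Fintype.card G.edgeSet := rfl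
      omega
    · exfalso
      apply hS
      obtain ⟨y, hy⟩ := not_forall.1 hall
      obtain ⟨c, k, hc, hk⟩ := ih (Nat.card {x | some x ∈ S})
        (hn ▸ Finite.card_subtype_lt (x := y) hy) (G.induce {x | some x ∈ S}) rfl
        (hG.induce _) (hfree.comap (Embedding.induce _).isContained) (T.subtype fun x => some x ∈ S)
        ((Finset.card_subtype _ _).trans_le ((Finset.card_filter_le _ _).trans hT))
      refine ⟨fun o => o.elim k fun x => if h : some x ∈ S then c ⟨x, h⟩ else 0, ?_⟩
      rintro (_ | u) hu (_ | v) hv huv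
      · exact huv.elim
      · simpa [hv] using (hk ⟨v, hv⟩ (Finset.mem_subtype.2 huv)).symm
      · simpa [hu] using hk ⟨u, hu⟩ (Finset.mem_subtype.2 huv)
      · simpa [hu, hv] using hc ⟨u, hu⟩ ⟨v, hv⟩ huv
  obtain ⟨i, hi⟩ := not_forall.1 hface
  obtain ⟨⟨e, he⟩, hi⟩ := Classical.not_imp.1 hi
  obtain ⟨z, hzface, hz⟩ : ∃ z : G.edgeSet → ZMod 2,
      (∀ e, z e = (Pi.single i 1 : ι → ZMod 2) (l e) + (Pi.single i 1 : ι → ZMod 2) (r e)) ∧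
      ∀ e, z e ≠ 0 ↔ ¬ (l e = i ↔ r e = i) := by
    refine ⟨_, fun e => rfl, fun e => ?_⟩
    by_cases hl : l e = i <;> by_cases hr : r e = i <;>
      simp [hl, hr, CharTwo.add_self_eq_zero]
  have hcycle := (hdual z).2 ⟨_, hzface⟩
  obtain ⟨a, b, c, d, e₁, e₂, e₃, e₄, hac, hbd, hz₁, hz₂, hz₃, hz₄, h₁, h₂, h₃, h₄⟩ :=
    IsAbstractDual.exists_fourCycle
      (fun e hee => (hadj rfl : G.Adj (s e) (t e)).ne hee)
      (fun e e' hee => Subtype.ext (by rw [← hst, ← hst, hee]))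
      (fun e₁ e₂ e₃ a b c h₁ h₂ h₃ => htri _ _ _ (hadj h₁) (hadj h₂) (hadj h₃))
      hcycle ⟨e, (hz e).2 he⟩ (by
        by_contra hlt
        exact hi ⟨_, Nat.lt_of_not_le hlt, fun e he => (hz e).1 (Finset.mem_filter.1 he).2⟩)
  rw [hz] at hz₁ hz₂ hz₃ hz₄
  by_cases hp : ∀ x y, G.Adj a x → G.Adj x y → ¬ G.Adj y c
  · exact step a c d e₃ e₄ i hac h₃ h₄ hz₃ hz₄ hp
  by_cases hq : ∀ z w, G.Adj b z → G.Adj z w → ¬ G.Adj w d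
  · exact step b d c e₃ e₂ i hbd (h₃.trans Sym2.eq_swap) (h₂.trans Sym2.eq_swap) hz₃
      hz₂ hq
  push Not at hp hq
  obtain ⟨x, y, hax, hxy, hyc⟩ := hp
  obtain ⟨z, w, hbz, hzw, hwd⟩ := hq
  exfalso
  obtain ⟨f₁, hf₁⟩ := hedge hax
  obtain ⟨f₂, hf₂⟩ := hedge hxy
  obtain ⟨f₃, hf₃⟩ := hedge hyc
  obtain ⟨g₁, hg₁⟩ := hedge hbz
  obtain ⟨g₂, hg₂⟩ := hedge hzw
  obtain ⟨g₃, hg₃⟩ := hedge hwd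
  have hside : ∀ e, ¬ (l e = i ↔ r e = i) → l e = i ∨ r e = i := fun e he => by tauto
  obtain ⟨m₁, m₂, m₃, m₄⟩ := disjoint_opposite_paths htri (hadj h₁) (hadj h₂) (hadj h₃) (hadj h₄)
    hax hxy hyc hbz hzw hwd
  exact hdual.not_paths hac hbd h₁ h₂ h₃ (hside _ hz₁) (hside _ hz₂) (hside _ hz₃) hf₁ hf₂ hf₃
    hg₁ hg₂ hg₃ m₁ m₂ m₃ m₄

end SimpleGraph

end Coloring

section Grid

/-- The edges of the square grid of side `N`: horizontal ones, then vertical ones. -/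
abbrev GridEdge (N : ℕ) := (Fin N × Fin (N + 1)) ⊕ (Fin (N + 1) × Fin N)

namespace GridEdge

variable {N : ℕ}

/-- The left or lower end of an edge. -/
def source : GridEdge N → ℕ × ℕ
  | .inl (i, j) => (i, j)
  | .inr (i, j) => (i, j)

/-- The right or upper end of an edge. -/
def target : GridEdge N → ℕ × ℕ
  | .inl (i, j) => (i + 1, j)
  | .inr (i, j) => (i, j + 1)

/-- The unit square with lower left corner `(i, j)`, or the outer face. -/
def face (N i j : ℕ) : Option (ℕ × ℕ) := if i < N ∧ j < N then some (i, j) else none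

/-- The face above or to the right of an edge. -/
def left : GridEdge N → Option (ℕ × ℕ)
  | .inl (i, j) => face N i j
  | .inr (i, j) => face N i j

/-- The face below or to the left of an edge. -/
def right : GridEdge N → Option (ℕ × ℕ)
  | .inl (i, j) => if j = 0 then none else face N i (j - 1)
  | .inr (i, j) => if i = 0 then none else face N (i - 1) j

lemma sum_face {i j : ℕ} (hi : i < N) (hj : j < N) (y : GridEdge N → ZMod 2) :
    ∑ e, y e * ((if left e = some (i, j) then 1 else 0) +
      (if right e = some (i, j) then 1 else 0)) =
    y (.inl (⟨i, hi⟩, ⟨j, by omega⟩)) + y (.inl (⟨i, hi⟩, ⟨j + 1, by omega⟩)) +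
      (y (.inr (⟨i, by omega⟩, ⟨j, hj⟩)) + y (.inr (⟨i + 1, by omega⟩, ⟨j, hj⟩))) := by
  rw [Fintype.sum_sum_type]
  congr 1
  · rw [← Finset.sum_subset (Finset.subset_univ {(⟨i, hi⟩, ⟨j, by omega⟩),
      (⟨i, hi⟩, ⟨j + 1, by omega⟩)}), Finset.sum_pair (by simp)]
    · simp only [left, right, face, hi, hj]
      simp
      rw [if_neg (by omega), add_zero, mul_one, if_pos (by assumption)]
    · rintro ⟨⟨a, ha⟩, ⟨b, hb⟩⟩ - hne
      simp only [Finset.mem_insert, Finset.mem_singleton, Prod.mk.injEq, Fin.mk.injEq] at hne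
      have h1 : left (.inl (⟨a, ha⟩, ⟨b, hb⟩) : GridEdge N) ≠ some (i, j) := by
        simp only [left, face]
        grind
      have h2 : right (.inl (⟨a, ha⟩, ⟨b, hb⟩) : GridEdge N) ≠ some (i, j) := by
        simp only [right, face, Fin.ext_iff, Fin.val_zero]
        grind
      simp [h1, h2]
  · rw [← Finset.sum_subset (Finset.subset_univ {(⟨i, by omega⟩, ⟨j, hj⟩),
      (⟨i + 1, by omega⟩, ⟨j, hj⟩)}), Finset.sum_pair (by simp)]
    · simp only [left, right, face, hi, hj]
      simp
      rw [if_neg (by omega), add_zero, mul_one, if_pos (by assumption)]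
    · rintro ⟨⟨a, ha⟩, ⟨b, hb⟩⟩ - hne
      simp only [Finset.mem_insert, Finset.mem_singleton, Prod.mk.injEq, Fin.mk.injEq] at hne
      have h1 : left (.inr (⟨a, ha⟩, ⟨b, hb⟩) : GridEdge N) ≠ some (i, j) := by
        simp only [left, face]
        grind
      have h2 : right (.inr (⟨a, ha⟩, ⟨b, hb⟩) : GridEdge N) ≠ some (i, j) := by
        simp only [right, face, Fin.ext_iff, Fin.val_zero]
        grind
      simp [h1, h2]

lemma isAbstractDual : IsAbstractDual (source (N := N)) target left right := by
  refine IsAbstractDual.symm fun y => ⟨fun hy => ?_, ?_⟩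
  · have hsq : ∀ i j (hi : i < N) (hj : j < N),
        y (.inl (⟨i, hi⟩, ⟨j, by omega⟩)) + y (.inl (⟨i, hi⟩, ⟨j + 1, by omega⟩)) +
        (y (.inr (⟨i, by omega⟩, ⟨j, hj⟩)) + y (.inr (⟨i + 1, by omega⟩, ⟨j, hj⟩))) = 0 := by
      intro i j hi hj
      exact (sum_face hi hj y).symm.trans (hy fun k => if k = some (i, j) then 1 else 0)
    let τ : ℕ × ℕ → ZMod 2 := fun p =>
      (∑ i ∈ Finset.range p.1, if h : i < N then y (.inl (⟨i, h⟩, 0)) else 0) +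
      ∑ j ∈ Finset.range p.2, if h : p.1 < N + 1 ∧ j < N then
        y (.inr (⟨p.1, h.1⟩, ⟨j, h.2⟩)) else 0
    have hv : ∀ i j (hi : i < N + 1) (hj : j < N),
        τ (i, j + 1) = τ (i, j) + y (.inr (⟨i, hi⟩, ⟨j, hj⟩)) := by
      intro i j hi hj
      simp only [τ, Finset.sum_range_succ]
      rw [dif_pos ⟨hi, hj⟩]
      ring
    have hh : ∀ j i (hi : i < N) (hj : j < N + 1),
        y (.inl (⟨i, hi⟩, ⟨j, hj⟩)) = τ (i, j) + τ (i + 1, j) := by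
      intro j i hi
      induction j with
      | zero =>
        intro hj
        simp only [τ, Finset.range_zero, Finset.sum_empty, add_zero, Finset.sum_range_succ,
          dif_pos hi]
        rw [← add_assoc, CharTwo.add_self_eq_zero, zero_add]
        rfl
      | succ j ih =>
        intro hj
        rw [hv i j (by omega) (by omega), hv (i + 1) j (by omega) (by omega)]
        have h1 := ih (by omega)
        have h2 := hsq i j hi (by omega)
        rw [h1] at h2
        rw [← CharTwo.add_eq_zero]
        linear_combination h2
    refine ⟨τ, ?_⟩
    rintro (⟨⟨i, hi⟩, ⟨j, hj⟩⟩ | ⟨⟨i, hi⟩, ⟨j, hj⟩⟩)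
    · exact hh j i hi hj
    · change _ = τ (i, j) + τ (i, j + 1)
      rw [hv i j hi hj, ← add_assoc, CharTwo.add_self_eq_zero, zero_add]
  · rintro ⟨τ, hτ⟩ σ
    have hσ : ∀ x : Option (ℕ × ℕ), (∀ k, x = some k → k ∈ Finset.range N ×ˢ Finset.range N) →
        σ x = σ none + ∑ k ∈ Finset.range N ×ˢ Finset.range N,
          (σ (some k) + σ none) * if x = some k then 1 else 0 := by
      rintro (_ | k) hk
      · simp
      · have := hk k rfl
        simp only [Option.some_inj, mul_ite, mul_one, mul_zero, Finset.sum_ite_eq, this, if_true]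
        linear_combination - CharTwo.add_self_eq_zero (σ none)
    have hface : ∀ i j k, face N i j = some k → k ∈ Finset.range N ×ˢ Finset.range N := by
      intro i j k hk
      simp only [face] at hk
      simp only [Finset.mem_product, Finset.mem_range]
      grind
    have hleft : ∀ (e : GridEdge N) k, left e = some k → k ∈ Finset.range N ×ˢ Finset.range N := by
      rintro (⟨i, j⟩ | ⟨i, j⟩) k hk <;> exact hface _ _ _ hk
    have hright : ∀ (e : GridEdge N) k, right e = some k →
        k ∈ Finset.range N ×ˢ Finset.range N := by
      rintro (⟨i, j⟩ | ⟨i, j⟩) k hk <;>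
      · simp only [right] at hk
        split_ifs at hk
        exact hface _ _ _ hk
    have hexp : ∀ e : GridEdge N, y e * (σ (left e) + σ (right e)) =
        ∑ k ∈ Finset.range N ×ˢ Finset.range N, (σ (some k) + σ none) *
          (y e * ((if left e = some k then 1 else 0) + if right e = some k then 1 else 0)) := by
      intro e
      rw [hσ _ (hleft e), hσ _ (hright e)]
      have : ∀ k, (σ (some k) + σ none) *
          (y e * ((if left e = some k then 1 else 0) + if right e = some k then 1 else 0)) =
          y e * ((σ (some k) + σ none) * (if left e = some k then 1 else 0) +
            (σ (some k) + σ none) * (if right e = some k then 1 else 0)) := fun k => by ring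
      simp only [this, ← Finset.mul_sum, Finset.sum_add_distrib]
      linear_combination y e * CharTwo.add_self_eq_zero (σ none)
    simp only [hexp]
    rw [Finset.sum_comm]
    refine Finset.sum_eq_zero fun ⟨i, j⟩ hk => ?_
    simp only [Finset.mem_product, Finset.mem_range] at hk
    rw [← Finset.mul_sum, sum_face hk.1 hk.2]
    simp only [hτ, source, target]
    linear_combination (σ (some (i, j)) + σ none) * (CharTwo.add_self_eq_zero (τ (i, j)) +
      CharTwo.add_self_eq_zero (τ (i + 1, j)) + CharTwo.add_self_eq_zero (τ (i, j + 1)) +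
      CharTwo.add_self_eq_zero (τ (i + 1, j + 1)))

end GridEdge

/-- Large square grids in `ℤ²` have abstract duals. -/
lemma exists_grid_isAbstractDual (N : ℕ) : ∃ (E : Type) (_ : Fintype E) (ι : Type)
    (s t : E → ℤ × ℤ) (l r : E → ι), IsAbstractDual s t l r ∧
      (∀ e, t e = s e + (1, 0) ∨ t e = s e + (0, 1)) ∧
      ∀ x y : ℤ, |x| < N → |y| < N → (∃ e, s e = (x, y) ∧ t e = (x + 1, y)) ∧
        ∃ e, s e = (x, y) ∧ t e = (x, y + 1) := by
  let φ : ℕ × ℕ → ℤ × ℤ := fun p => ((p.1 : ℤ) - N, (p.2 : ℤ) - N)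
  have hφ : φ.Injective := by
    rintro ⟨a, b⟩ ⟨c, d⟩ h
    simp only [φ, Prod.mk.injEq] at h ⊢
    omega
  refine ⟨GridEdge (2 * N), inferInstance, _, φ ∘ GridEdge.source, φ ∘ GridEdge.target, _, _,
    GridEdge.isAbstractDual.congr_cut fun y => ⟨?_, ?_⟩, ?_, ?_⟩
  · rintro ⟨τ, hτ⟩
    exact ⟨Function.extend φ τ 0, by simpa only [Function.comp, hφ.extend_apply] using hτ⟩
  · rintro ⟨τ, hτ⟩
    exact ⟨τ ∘ φ, hτ⟩
  · rintro (⟨i, j⟩ | ⟨i, j⟩)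
    · left
      ext <;> simp [φ, GridEdge.source, GridEdge.target]
      ring
    · right
      ext <;> simp [φ, GridEdge.source, GridEdge.target]
      ring
  · intro x y hx hy
    rw [abs_lt] at hx hy
    refine ⟨⟨.inl (⟨(x + N).toNat, by omega⟩, ⟨(y + N).toNat, by omega⟩), ?_, ?_⟩,
      ⟨.inr (⟨(x + N).toNat, by omega⟩, ⟨(y + N).toNat, by omega⟩), ?_, ?_⟩⟩ <;>
    simp only [Function.comp, φ, GridEdge.source, GridEdge.target, Prod.mk.injEq] <;> omega

end Grid

section GridMinor

/-- `d` is the cell to the right of or above the cell `c`. -/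
def GridStep (c d : ℤ × ℤ) : Prop := d = c + (1, 0) ∨ d = c + (0, 1)

/-- A set of cells is grid-connected if functions constant along the steps inside it are
constant. -/
def GridConnected (B : Set (ℤ × ℤ)) : Prop :=
  ∀ τ : ℤ × ℤ → ZMod 2, (∀ c ∈ B, ∀ d ∈ B, GridStep c d → τ c = τ d) → ∀ c ∈ B, ∀ d ∈ B, τ c = τ d

/-- Minors of grids are planar. -/
lemma SimpleGraph.DualPlanar.of_gridMinor [Finite V] (G : SimpleGraph V) (B : V → Set (ℤ × ℤ))
    (hne : ∀ u, (B u).Nonempty) (hdisj : ∀ u v c, c ∈ B u → c ∈ B v → u = v)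
    (hconn : ∀ u, GridConnected (B u)) (N : ℕ) (hN : ∀ u, ∀ c ∈ B u, |c.1| < N ∧ |c.2| < N)
    (hadj : ∀ u v, G.Adj u v → ∃ c ∈ B u, ∃ d ∈ B v, GridStep c d ∨ GridStep d c) :
    G.DualPlanar := by
  classical
  have := Fintype.ofFinite V
  obtain ⟨E, _, ι, s, t, l, r, hdual, hst, hgrid⟩ := exists_grid_isAbstractDual N
  have hstep : ∀ u, ∀ c ∈ B u, ∀ d, GridStep c d → ∃ e, s e = c ∧ t e = d := by
    rintro u ⟨x, y⟩ hc d (rfl | rfl)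
    · obtain ⟨e, h1, h2⟩ := (hgrid x y (hN u _ hc).1 (hN u _ hc).2).1
      exact ⟨e, h1, by simpa using h2⟩
    · obtain ⟨e, h1, h2⟩ := (hgrid x y (hN u _ hc).1 (hN u _ hc).2).2
      exact ⟨e, h1, by simpa using h2⟩
  have hends : ∀ e : G.edgeSet, ∃ u v g, s(u, v) = e.1 ∧ s g ∈ B u ∧ t g ∈ B v := by
    rintro ⟨e, he⟩
    induction e with
    | h u v =>
      obtain ⟨c, hc, d, hd, hcd | hdc⟩ := hadj u v he
      · obtain ⟨g, rfl, rfl⟩ := hstep u c hc d hcd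
        exact ⟨u, v, g, rfl, hc, hd⟩
      · obtain ⟨g, rfl, rfl⟩ := hstep v d hd c hdc
        exact ⟨v, u, g, Sym2.eq_swap, hd, hc⟩
  choose a b g hab ha hb using hends
  have hadj' : ∀ e, G.Adj (a e) (b e) := fun e => by
    rw [← mem_edgeSet, hab]
    exact e.2
  have hinj : g.Injective := by
    intro e e' h
    rw [Subtype.ext_iff, ← hab, ← hab, hdisj _ _ _ (ha e) (h ▸ ha e'),
      hdisj _ _ _ (hb e) (h ▸ hb e')]
  obtain ⟨ι', l', r', hd⟩ := hdual.minor {k | ∃ u, s k ∈ B u ∧ t k ∈ B u} hinj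
    (fun e ⟨u, hs, ht⟩ => (hadj' e).ne ((hdisj _ _ _ (ha e) hs).trans (hdisj _ _ _ ht (hb e))))
    (s' := a) (t' := b) fun y => by
      constructor
      · rintro ⟨τ, hτ, hy⟩
        have hconst : ∀ u, ∀ c ∈ B u, τ c = τ (hne u).some := fun u c hc =>
          hconn u τ (fun c hc d hd hcd => by
            obtain ⟨e, rfl, rfl⟩ := hstep u c hc d hcd
            exact hτ e ⟨u, hc, hd⟩) c hc _ (hne u).some_mem
        exact ⟨fun u => τ (hne u).some, fun e => by
          rw [hy, hconst _ _ (ha e), hconst _ _ (hb e)]⟩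
      · rintro ⟨τ, hτ⟩
        have hval : ∀ u, ∀ c ∈ B u, (if h : ∃ u, c ∈ B u then τ h.choose else 0) = τ u := by
          intro u c hc
          have h : ∃ u, c ∈ B u := ⟨u, hc⟩
          rw [dif_pos h, hdisj _ _ _ h.choose_spec hc]
        refine ⟨fun c => if h : ∃ u, c ∈ B u then τ h.choose else 0, ?_, fun e => ?_⟩
        · rintro e ⟨u, hs, ht⟩
          exact (hval _ _ hs).trans (hval _ _ ht).symm
        · exact (hτ e).trans (congrArg₂ (· + ·) (hval _ _ (ha e)).symm (hval _ _ (hb e)).symm)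
  exact ⟨_, _, ι', a, b, l', r', hd, fun u v huv => ⟨⟨s(u, v), huv⟩, hab _⟩⟩

lemma gridConnected_prod {P Q : Set ℤ} (hP : P.OrdConnected) (hQ : Q.OrdConnected) :
    GridConnected (P ×ˢ Q) := by
  have key : ∀ {R : Set ℤ}, R.OrdConnected → ∀ f : ℤ → ZMod 2,
      (∀ x ∈ R, x + 1 ∈ R → f x = f (x + 1)) → ∀ x ∈ R, ∀ y ∈ R, f x = f y := by
    intro R hR f hf
    have hle : ∀ x ∈ R, ∀ y, x ≤ y → y ∈ R → f x = f y := by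
      intro x hx y hxy
      induction y, hxy using Int.leInduction with
      | base => exact fun _ => rfl
      | succ y hxy ih =>
        intro hy
        have hy' : y ∈ R := hR.out hx hy ⟨hxy, by omega⟩
        rw [ih hy', hf y hy' hy]
    intro x hx y hy
    rcases le_total x y with h | h
    · exact hle x hx y h hy
    · exact (hle y hy x h hx).symm
  rintro τ hτ ⟨x, y⟩ ⟨hx, hy⟩ ⟨x', y'⟩ ⟨hx', hy'⟩
  dsimp only at hx hy hx' hy'
  calc τ (x, y) = τ (x', y) := key hP (fun z => τ (z, y)) (fun z hz hz1 =>
        hτ (z, y) ⟨hz, hy⟩ (z + 1, y) ⟨hz1, hy⟩ (Or.inl (by simp))) _ hx _ hx'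
    _ = τ (x', y') := key hQ (fun z => τ (x', z)) (fun z hz hz1 =>
        hτ (x', z) ⟨hx', hz⟩ (x', z + 1) ⟨hx', hz1⟩ (Or.inr (by simp))) _ hy _ hy'

end GridMinor

section Discretize

/-- The point of the plane at the corner of a cell of the grid of mesh `h`. -/
def gridPoint (h : ℝ) (c : ℤ × ℤ) : ℝ × ℝ := (c.1 * h, c.2 * h)

/-- The cell of the grid of mesh `h` containing a point. -/
noncomputable def gridFloor (h : ℝ) (x : ℝ × ℝ) : ℤ × ℤ := (⌊x.1 / h⌋, ⌊x.2 / h⌋)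

lemma dist_gridPoint_le {h : ℝ} {c : ℤ × ℤ} {x : ℝ × ℝ} {r : ℝ} :
    dist (gridPoint h c) x ≤ r ↔ |c.1 * h - x.1| ≤ r ∧ |c.2 * h - x.2| ≤ r := by
  rw [Prod.dist_eq, max_le_iff, Real.dist_eq, Real.dist_eq]
  rfl

lemma abs_floor_sub_mul_sub_le {h : ℝ} (hh : 0 < h) (x : ℝ) {i : ℤ} (hi : i = 0 ∨ i = 1) :
    |((⌊x / h⌋ - i : ℤ) : ℝ) * h - x| ≤ (1 + i) * h := by
  have h1 : (⌊x / h⌋ : ℝ) * h ≤ x := (le_div_iff₀ hh).1 (Int.floor_le _)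
  have h2 : x < (⌊x / h⌋ + 1 : ℝ) * h := (div_lt_iff₀ hh).1 (Int.lt_floor_add_one _)
  rw [abs_le]
  push_cast
  rcases hi with rfl | rfl <;> constructor <;> push_cast <;> nlinarith

lemma dist_gridPoint_gridFloor_le {h : ℝ} (hh : 0 < h) (x : ℝ × ℝ) :
    dist (gridPoint h (gridFloor h x)) x ≤ h := by
  rw [dist_gridPoint_le]
  constructor
  · simpa [gridFloor] using abs_floor_sub_mul_sub_le hh x.1 (i := 0) (Or.inl rfl)
  · simpa [gridFloor] using abs_floor_sub_mul_sub_le hh x.2 (i := 0) (Or.inl rfl)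

lemma eventually_floor_div (h x : ℝ) :
    ∀ᶠ y in nhds x, ∃ i : ℤ, (i = 0 ∨ i = 1) ∧ ⌊y / h⌋ = ⌊x / h⌋ - i := by
  have hc : Filter.Tendsto (fun y : ℝ => y / h) (nhds x) (nhds (x / h)) :=
    Filter.tendsto_id.div_const h
  have h1 : (⌊x / h⌋ : ℝ) - 1 < x / h := by linarith [Int.floor_le (x / h)]
  filter_upwards [hc.eventually_const_lt h1, hc.eventually_lt_const (Int.lt_floor_add_one (x / h))]
    with y hy1 hy2
  have h3 : ⌊x / h⌋ - 1 ≤ ⌊y / h⌋ := Int.le_floor.2 (by push_cast; exact hy1.le)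
  have h4 : ⌊y / h⌋ < ⌊x / h⌋ + 1 := Int.floor_lt.2 (by push_cast; exact hy2)
  exact ⟨⌊x / h⌋ - ⌊y / h⌋, by omega, by omega⟩

/-- The cells near a connected set are joined to each other by steps near that set. -/
lemma IsPreconnected.mem_gridFloor_iff {h : ℝ} (hh : 0 < h) {A : Set (ℝ × ℝ)}
    (hA : IsPreconnected A) {C : Set (ℤ × ℤ)}
    (hC : ∀ c d, (∃ x ∈ A, dist (gridPoint h c) x ≤ 2 * h) →
      (∃ x ∈ A, dist (gridPoint h d) x ≤ 2 * h) → GridStep c d → (c ∈ C ↔ d ∈ C))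
    {x y : ℝ × ℝ} (hx : x ∈ A) (hy : y ∈ A) : gridFloor h x ∈ C ↔ gridFloor h y ∈ C := by
  classical
  have hcont : ContinuousOn (fun x => decide (gridFloor h x ∈ C)) A := by
    intro x hx
    refine (continuousWithinAt_const (b := decide (gridFloor h x ∈ C))).congr_of_eventuallyEq ?_ rfl
    refine Filter.Eventually.filter_mono nhdsWithin_le_nhds ?_
    rw [nhds_prod_eq]
    filter_upwards [(eventually_floor_div h x.1).prod_mk (eventually_floor_div h x.2)]
      with y ⟨⟨i, hi, hyi⟩, j, hj, hyj⟩
    have hnear : ∀ i j : ℤ, (i = 0 ∨ i = 1) → (j = 0 ∨ j = 1) → ∃ z ∈ A,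
        dist (gridPoint h (⌊x.1 / h⌋ - i, ⌊x.2 / h⌋ - j)) z ≤ 2 * h := by
      intro i j hi hj
      have hle : ∀ k : ℤ, (k = 0 ∨ k = 1) → (1 + k : ℝ) * h ≤ 2 * h := by
        rintro k (rfl | rfl) <;> push_cast <;> linarith
      exact ⟨x, hx, dist_gridPoint_le.2 ⟨(abs_floor_sub_mul_sub_le hh x.1 hi).trans (hle i hi),
        (abs_floor_sub_mul_sub_le hh x.2 hj).trans (hle j hj)⟩⟩
    have hfst : ∀ j : ℤ, (j = 0 ∨ j = 1) → ((⌊x.1 / h⌋ - 1, ⌊x.2 / h⌋ - j) ∈ C ↔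
        (⌊x.1 / h⌋ - 0, ⌊x.2 / h⌋ - j) ∈ C) := fun j hj =>
      hC _ _ (hnear 1 j (Or.inr rfl) hj) (hnear 0 j (Or.inl rfl) hj) (Or.inl (by simp))
    have hsnd : ((⌊x.1 / h⌋ - 0, ⌊x.2 / h⌋ - 1) ∈ C ↔ (⌊x.1 / h⌋ - 0, ⌊x.2 / h⌋ - 0) ∈ C) :=
      hC _ _ (hnear 0 1 (Or.inl rfl) (Or.inr rfl)) (hnear 0 0 (Or.inl rfl) (Or.inl rfl))
        (Or.inr (by simp))
    have hfloor : gridFloor h x = (⌊x.1 / h⌋ - 0, ⌊x.2 / h⌋ - 0) := by simp [gridFloor]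
    rw [decide_eq_decide, hfloor, gridFloor, hyi, hyj]
    rcases hi with rfl | rfl
    · rcases hj with rfl | rfl
      · exact Iff.rfl
      · exact hsnd
    · rw [hfst j hj]
      rcases hj with rfl | rfl
      · exact Iff.rfl
      · exact hsnd
  exact decide_eq_decide.1 (hA.constant hcont hx hy)

/-- A drawing whose parts keep a positive distance can be discretized. -/
theorem dualPlanar_of_thick_drawing [Finite V] (G : SimpleGraph V) (p : V → ℝ × ℝ)
    (a b : G.edgeSet → V) (A : G.edgeSet → Set (ℝ × ℝ)) (hab : ∀ e, s(a e, b e) = e.1) {r ε : ℝ}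
    (hε : 0 < ε) (hr : ε ≤ r) (hp : ∀ u v, u ≠ v → 2 * r + ε ≤ dist (p u) (p v))
    (hAp : ∀ e w, w ≠ a e → w ≠ b e → ∀ x ∈ A e, r + ε ≤ dist x (p w))
    (hAA : ∀ e e', e ≠ e' → ∀ x ∈ A e, ∀ y ∈ A e', ε ≤ dist x y)
    (hconn : ∀ e, IsPreconnected (A e)) (hbdd : ∀ e, Bornology.IsBounded (A e))
    (ha : ∀ e, ∃ x ∈ A e, dist x (p (a e)) ≤ r - ε)
    (hb : ∀ e, ∃ x ∈ A e, dist x (p (b e)) ≤ r - ε) : G.DualPlanar := by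
  have hne : ∀ e, a e ≠ b e := fun e => by
    have : G.Adj (a e) (b e) := by
      rw [← SimpleGraph.mem_edgeSet, hab]
      exact e.2
    exact this.ne
  obtain ⟨h, hh, hhε⟩ : ∃ h : ℝ, 0 < h ∧ 8 * h = ε := ⟨ε / 8, by positivity, by ring⟩
  have htri : ∀ (c : ℤ × ℤ) (x y : ℝ × ℝ), dist x y ≤ dist (gridPoint h c) x +
      dist (gridPoint h c) y := fun c x y => dist_triangle_left x y _
  let box : V → Set (ℤ × ℤ) := fun w => {c | dist (gridPoint h c) (p w) ≤ r}
  let near : G.edgeSet → Set (ℤ × ℤ) := fun e => {c | ∃ x ∈ A e, dist (gridPoint h c) x ≤ 2 * h}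
  let R : G.edgeSet → ℤ × ℤ → ℤ × ℤ → Prop := fun e c d =>
    d ∈ near e ∧ d ∉ box (b e) ∧ (GridStep c d ∨ GridStep d c)
  let C : G.edgeSet → Set (ℤ × ℤ) := fun e =>
    {c | ∃ c₀ ∈ near e, c₀ ∈ box (a e) ∧ Relation.ReflTransGen (R e) c₀ c}
  let B : V → Set (ℤ × ℤ) := fun w => {c | c ∈ box w ∨ ∃ e, a e = w ∧ c ∈ C e}
  have hbox : ∀ u v c, c ∈ box u → c ∈ box v → u = v := by
    intro u v c hu hv
    by_contra huv
    have h1 : dist (gridPoint h c) (p u) ≤ r := hu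
    have h2 : dist (gridPoint h c) (p v) ≤ r := hv
    linarith [hp u v huv, htri c (p u) (p v)]
  have hnear : ∀ e e' c, c ∈ near e → c ∈ near e' → e = e' := by
    rintro e e' c ⟨x, hx, hcx⟩ ⟨y, hy, hcy⟩
    by_contra hee
    linarith [hAA e e' hee x hx y hy, htri c x y]
  have hnearbox : ∀ e w c, c ∈ near e → c ∈ box w → w = a e ∨ w = b e := by
    rintro e w c ⟨x, hx, hcx⟩ hc
    by_contra hw
    rw [not_or] at hw
    have h1 : dist (gridPoint h c) (p w) ≤ r := hc
    linarith [hAp e w hw.1 hw.2 x hx, htri c x (p w)]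
  have hCnear : ∀ e, ∀ c ∈ C e, c ∈ near e ∧ c ∉ box (b e) := by
    rintro e c ⟨c₀, hc₀, hbox₀, hrel⟩
    induction hrel with
    | refl => exact ⟨hc₀, fun hcb => hne e (hbox _ _ _ hbox₀ hcb)⟩
    | tail _ hR _ => exact ⟨hR.1, hR.2.1⟩
  have hfloor : ∀ (x y : ℝ × ℝ), dist x y ≤ r - ε → dist (gridPoint h (gridFloor h x)) y ≤ r := by
    intro x y hxy
    linarith [dist_triangle (gridPoint h (gridFloor h x)) x y, dist_gridPoint_gridFloor_le hh x]
  have hfloornear : ∀ e, ∀ x ∈ A e, gridFloor h x ∈ near e := fun e x hx =>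
    ⟨x, hx, by linarith [dist_gridPoint_gridFloor_le hh x]⟩
  have hcenter : ∀ w, gridFloor h (p w) ∈ box w := fun w => hfloor _ _ (by
    rw [dist_self]
    linarith)
  have hcross : ∀ e, ∃ c ∈ C e, ∃ d ∈ box (b e), GridStep c d ∨ GridStep d c := by
    intro e
    by_contra! hcon
    obtain ⟨x, hx, hxa⟩ := ha e
    obtain ⟨y, hy, hyb⟩ := hb e
    have hextend : ∀ c d, c ∈ C e → d ∈ near e → (GridStep c d ∨ GridStep d c) → d ∈ C e := by
      rintro c d hc hd hcd
      by_cases hdb : d ∈ box (b e)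
      · exact absurd hcd (not_or.2 (hcon c hc d hdb))
      · obtain ⟨c₀, h1, h2, h3⟩ := hc
        exact ⟨c₀, h1, h2, h3.tail ⟨hd, hdb, hcd⟩⟩
    have hiff := (hconn e).mem_gridFloor_iff hh (C := C e) (fun c d hc hd hcd =>
      ⟨fun h => hextend c d h hd (Or.inl hcd), fun h => hextend d c h hc (Or.inr hcd)⟩) hx hy
    exact (hCnear e _ (hiff.1 ⟨_, hfloornear e x hx, hfloor _ _ hxa, .refl⟩)).2 (hfloor _ _ hyb)
  have hordc : ∀ y : ℝ, {k : ℤ | |k * h - y| ≤ r}.OrdConnected := by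
    refine fun y => ⟨fun i hi j hj k hk => ?_⟩
    have h1 : (i : ℝ) * h ≤ k * h := mul_le_mul_of_nonneg_right (by exact_mod_cast hk.1) hh.le
    have h2 : (k : ℝ) * h ≤ j * h := mul_le_mul_of_nonneg_right (by exact_mod_cast hk.2) hh.le
    have hi' := abs_le.1 (show |(i : ℝ) * h - y| ≤ r from hi)
    have hj' := abs_le.1 (show |(j : ℝ) * h - y| ≤ r from hj)
    exact show |(k : ℝ) * h - y| ≤ r from abs_le.2 ⟨by linarith, by linarith⟩
  have hboxconn : ∀ w, GridConnected (box w) := by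
    intro w
    have : box w = {k : ℤ | |k * h - (p w).1| ≤ r} ×ˢ {k : ℤ | |k * h - (p w).2| ≤ r} := by
      ext c
      exact dist_gridPoint_le
    rw [this]
    exact gridConnected_prod (hordc _) (hordc _)
  obtain ⟨M, hM⟩ : ∃ M, (Set.range p ∪ ⋃ e, A e) ⊆ Metric.closedBall 0 M :=
    (((Set.finite_range p).isBounded).union (Bornology.isBounded_iUnion.2 hbdd)).subset_closedBall 0
  obtain ⟨N, hN⟩ := exists_nat_gt ((M + r) / h)
  rw [div_lt_iff₀ hh] at hN
  have hbound : ∀ c x, x ∈ Set.range p ∪ ⋃ e, A e → dist (gridPoint h c) x ≤ r →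
      |c.1| < N ∧ |c.2| < N := by
    intro c x hx hcx
    have h1 : dist (gridPoint h c) 0 ≤ M + r := by
      linarith [dist_triangle (gridPoint h c) x 0, Metric.mem_closedBall.1 (hM hx)]
    have h2 := dist_gridPoint_le.1 h1
    have h3 : ∀ k : ℤ, |(k : ℝ) * h - 0| ≤ M + r → |k| < N := by
      intro k hk
      rw [sub_zero, abs_mul, abs_of_pos hh] at hk
      have : |(k : ℝ)| < N := lt_of_mul_lt_mul_right (hk.trans_lt hN) hh.le
      exact_mod_cast this
    exact ⟨h3 _ h2.1, h3 _ h2.2⟩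
  refine SimpleGraph.DualPlanar.of_gridMinor G B (fun u => ⟨_, Or.inl (hcenter u)⟩) ?_ ?_ N ?_ ?_
  · rintro u v c (hu | ⟨e, rfl, hu⟩) (hv | ⟨e', rfl, hv⟩)
    · exact hbox u v c hu hv
    · rcases hnearbox e' u c (hCnear _ _ hv).1 hu with rfl | rfl
      · rfl
      · exact absurd hu (hCnear _ _ hv).2
    · rcases hnearbox e v c (hCnear _ _ hu).1 hv with rfl | rfl
      · rfl
      · exact absurd hv (hCnear _ _ hu).2
    · rw [hnear e e' c (hCnear _ _ hu).1 (hCnear _ _ hv).1]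
  · intro w τ hτ
    have hcenter' : ∀ c ∈ box w, τ c = τ (gridFloor h (p w)) := fun c hc =>
      hboxconn w τ (fun c hc d hd => hτ c (Or.inl hc) d (Or.inl hd)) c hc _ (hcenter w)
    have hall : ∀ c ∈ B w, τ c = τ (gridFloor h (p w)) := by
      rintro c (hc | ⟨e, rfl, c₀, hc₀, hbox₀, hrel⟩)
      · exact hcenter' c hc
      · rw [← hcenter' c₀ hbox₀]
        induction hrel with
        | refl => rfl
        | tail hrel hR ih =>
          rw [← ih]
          have h1 : _ ∈ B (a e) := Or.inr ⟨e, rfl, c₀, hc₀, hbox₀, hrel⟩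
          have h2 : _ ∈ B (a e) := Or.inr ⟨e, rfl, c₀, hc₀, hbox₀, hrel.tail hR⟩
          rcases hR.2.2 with h3 | h3
          · exact (hτ _ h1 _ h2 h3).symm
          · exact hτ _ h2 _ h1 h3
    exact fun c hc d hd => (hall c hc).trans (hall d hd).symm
  · rintro u c (hc | ⟨e, rfl, hc⟩)
    · exact hbound c _ (Or.inl ⟨u, rfl⟩) hc
    · obtain ⟨x, hx, hcx⟩ := (hCnear e c hc).1
      exact hbound c x (Or.inr (Set.mem_iUnion.2 ⟨e, hx⟩)) (by linarith)
  · intro u v huv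
    obtain ⟨c, hc, d, hd, hcd⟩ := hcross ⟨s(u, v), huv⟩
    have hc' : c ∈ B (a ⟨s(u, v), huv⟩) := Or.inr ⟨_, rfl, hc⟩
    have hd' : d ∈ B (b ⟨s(u, v), huv⟩) := Or.inl hd
    rcases Sym2.eq_iff.1 (hab ⟨s(u, v), huv⟩) with ⟨h1, h2⟩ | ⟨h1, h2⟩ <;> rw [h1] at hc' <;>
      rw [h2] at hd'
    · exact ⟨c, hc', d, hd', hcd⟩
    · exact ⟨d, hd', c, hc', hcd.symm⟩

end Discretize

section Drawing

open Filter Topology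

lemma exists_pos_forall_lt_dist {ι X : Type*} [Finite ι] [MetricSpace X] {K L : ι → Set X}
    (hK : ∀ i, IsCompact (K i)) (hL : ∀ i, IsCompact (L i)) (hd : ∀ i, Disjoint (K i) (L i)) :
    ∃ δ : ℝ, 0 < δ ∧ ∀ i, ∀ x ∈ K i, ∀ y ∈ L i, δ ≤ dist x y := by
  have key : ∀ i, ∀ᶠ δ in 𝓝[>] (0 : ℝ), ∀ x ∈ K i, ∀ y ∈ L i, δ ≤ dist x y := by
    intro i
    obtain ⟨δ, hδ, h⟩ := Metric.exists_pos_forall_lt_edist (hK i) (hL i).isClosed (hd i)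
    filter_upwards [Ioc_mem_nhdsGT (NNReal.coe_pos.2 hδ)] with η hη x hx y hy
    have := h x hx y hy
    rw [edist_nndist, ENNReal.coe_lt_coe, ← NNReal.coe_lt_coe, coe_nndist] at this
    exact hη.2.trans this.le
  obtain ⟨δ, h, hδ⟩ := ((eventually_all.2 key).and self_mem_nhdsWithin).exists
  exact ⟨δ, hδ, h⟩

/-- Graphs drawn in the plane are planar in the combinatorial sense. -/
theorem dualPlanar_of_isPlanar [Finite V] {G : SimpleGraph V} (hG : G.IsPlanar) :
    G.DualPlanar := by
  obtain ⟨D⟩ := hG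
  have hends : ∀ e : G.edgeSet, ∃ u v, s(u, v) = e.1 ∧ G.Adj u v := by
    rintro ⟨e, he⟩
    induction e with
    | h u v => exact ⟨u, v, rfl, he⟩
  choose a b hab hadj using hends
  let γ : G.edgeSet → ℝ → ℝ × ℝ := fun e => D.edgeArc (a e) (b e) (hadj e)
  have hγ : ∀ e, ContinuousOn (γ e) (Set.Icc 0 1) := fun e => D.arc_cont _ _ _
  have hγ0 : ∀ e, γ e 0 = D.vertexPos (a e) := fun e => D.arc_start _ _ _
  have hγ1 : ∀ e, γ e 1 = D.vertexPos (b e) := fun e => D.arc_end _ _ _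
  obtain ⟨r₁, hr₁, hvert⟩ := exists_pos_forall_lt_dist (ι := {q : V × V // q.1 ≠ q.2})
    (K := fun q => {D.vertexPos q.1.1}) (L := fun q => {D.vertexPos q.1.2})
    (fun _ => isCompact_singleton) (fun _ => isCompact_singleton)
    (fun q => Set.disjoint_singleton.2 (D.vertexInj.ne q.2))
  obtain ⟨r₂, hr₂, havoid⟩ := exists_pos_forall_lt_dist
    (ι := {q : G.edgeSet × V // q.2 ≠ a q.1 ∧ q.2 ≠ b q.1})
    (K := fun q => γ q.1.1 '' Set.Icc 0 1) (L := fun q => {D.vertexPos q.1.2})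
    (fun q => isCompact_Icc.image_of_continuousOn (hγ _)) (fun _ => isCompact_singleton) (by
      rintro ⟨⟨e, w⟩, hwa, hwb⟩
      rw [Set.disjoint_singleton_right]
      rintro ⟨t, ht, hw⟩
      rcases ht.1.eq_or_lt with rfl | h0
      · exact hwa (D.vertexInj (hw.symm.trans (hγ0 e)))
      rcases ht.2.eq_or_lt with rfl | h1
      · exact hwb (D.vertexInj (hw.symm.trans (hγ1 e)))
      · exact D.arc_avoid _ _ (hadj e) w ⟨t, ⟨h0, h1⟩, hw⟩)
  obtain ⟨r, hr, hr1, hr2⟩ : ∃ r, 0 < r ∧ 3 * r ≤ r₁ ∧ 2 * r ≤ r₂ :=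
    ⟨min r₁ r₂ / 3, by positivity, by linarith [min_le_left r₁ r₂],
      by linarith [min_le_right r₁ r₂, lt_min hr₁ hr₂]⟩
  have hcut : ∀ e, ∃ δ : ℝ, 0 < δ ∧ δ ≤ 1 / 2 ∧ dist (γ e δ) (D.vertexPos (a e)) ≤ r / 2 ∧
      dist (γ e (1 - δ)) (D.vertexPos (b e)) ≤ r / 2 := by
    intro e
    have h0 : Tendsto (fun δ : ℝ => γ e δ) (𝓝[>] 0) (𝓝 (D.vertexPos (a e))) := by
      have := hγ e 0 ⟨le_rfl, zero_le_one⟩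
      rw [ContinuousWithinAt, hγ0] at this
      exact this.mono_left (nhdsWithin_le_of_mem (Icc_mem_nhdsGT zero_lt_one))
    have h1 : Tendsto (fun δ : ℝ => γ e (1 - δ)) (𝓝[>] 0) (𝓝 (D.vertexPos (b e))) := by
      have := hγ e 1 ⟨zero_le_one, le_rfl⟩
      rw [ContinuousWithinAt, hγ1] at this
      refine this.comp (tendsto_nhdsWithin_iff.2 ⟨?_, ?_⟩)
      · exact ((continuous_const.sub continuous_id).tendsto' (0 : ℝ) 1 (sub_zero 1)).mono_left
          nhdsWithin_le_nhds
      · filter_upwards [Ioc_mem_nhdsGT (zero_lt_one (α := ℝ))] with δ hδ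
        exact ⟨by linarith [hδ.2], by linarith [hδ.1]⟩
    obtain ⟨δ, hδ0, hδ1, hδ⟩ := ((h0.eventually (Metric.closedBall_mem_nhds _ (half_pos hr))).and
      ((h1.eventually (Metric.closedBall_mem_nhds _ (half_pos hr))).and
        (Ioc_mem_nhdsGT (one_half_pos (α := ℝ))))).exists
    exact ⟨δ, hδ.1, hδ.2, hδ0, hδ1⟩
  choose δ hδ0 hδ1 hδa hδb using hcut
  let A : G.edgeSet → Set (ℝ × ℝ) := fun e => γ e '' Set.Icc (δ e) (1 - δ e)
  have hsub : ∀ e, Set.Icc (δ e) (1 - δ e) ⊆ Set.Ioo 0 1 := fun e t ht =>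
    ⟨(hδ0 e).trans_le ht.1, ht.2.trans_lt (by linarith [hδ0 e])⟩
  have hsub' : ∀ e, Set.Icc (δ e) (1 - δ e) ⊆ Set.Icc 0 1 := fun e =>
    (hsub e).trans Set.Ioo_subset_Icc_self
  have hA : ∀ e, IsCompact (A e) := fun e =>
    isCompact_Icc.image_of_continuousOn ((hγ e).mono (hsub' e))
  obtain ⟨ε₁, hε₁, hAA⟩ := exists_pos_forall_lt_dist (ι := {q : G.edgeSet × G.edgeSet // q.1 ≠ q.2})
    (K := fun q => A q.1.1) (L := fun q => A q.1.2) (fun _ => hA _) (fun _ => hA _) (by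
      rintro ⟨⟨e, e'⟩, hne⟩
      have := D.arc_disjoint _ _ (hadj e) _ _ (hadj e') (by
        rw [hab, hab]
        exact fun h => hne (Subtype.ext h))
      exact (Set.disjoint_iff_inter_eq_empty.2 this).mono (Set.image_mono (hsub e))
        (Set.image_mono (hsub' e')))
  have hεr : min ε₁ (r / 2) ≤ r / 2 := min_le_right _ _
  refine dualPlanar_of_thick_drawing G D.vertexPos a b A hab (r := r) (ε := min ε₁ (r / 2))
    (by positivity) (by linarith) (fun u v huv => ?_) (fun e w hwa hwb x hx => ?_)
    (fun e e' hee x hx y hy => (min_le_left _ _).trans (hAA ⟨(e, e'), hee⟩ x hx y hy))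
    (fun e => isPreconnected_Icc.image _ ((hγ e).mono (hsub' e))) (fun e => (hA e).isBounded)
    (fun e => ⟨_, ⟨δ e, ⟨le_rfl, by linarith [hδ1 e]⟩, rfl⟩, by linarith [hδa e]⟩)
    (fun e => ⟨_, ⟨1 - δ e, ⟨by linarith [hδ1 e], le_rfl⟩, rfl⟩, by linarith [hδb e]⟩)
  · linarith [hvert ⟨(u, v), huv⟩ _ rfl _ rfl]
  · linarith [havoid ⟨(e, w), hwa, hwb⟩ x (Set.image_mono (hsub' e) hx) _ rfl]

end Drawing

/-- If deleting a vertex of degree at most 3 from `H` yields a planar triangle-free graph,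
then `H` is 3-colorable. -/
theorem three_colorable_of_deleteVertex_planar_triangleFree [Fintype V]
    (H : SimpleGraph V) [DecidableRel H.Adj] (v : V) (hdeg : H.degree v ≤ 3)
    (hplanar : (H.induce ({v}ᶜ : Set V)).IsPlanar)
    (htf : (H.induce ({v}ᶜ : Set V)).CliqueFree 3) : H.Colorable 3 := by
  classical
  let T : Finset ({v}ᶜ : Set V) := Finset.univ.filter fun x => H.Adj v x
  have hT : T.card ≤ 3 := by
    refine le_trans ?_ hdeg
    rw [← Finset.card_map (Function.Embedding.subtype (· ∈ ({v}ᶜ : Set V))),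
      ← H.card_neighborFinset_eq_degree]
    refine Finset.card_le_card fun x hx => ?_
    obtain ⟨y, hy, rfl⟩ := Finset.mem_map.1 hx
    exact (H.mem_neighborFinset v _).2 (Finset.mem_filter.1 hy).2
  obtain ⟨c, k, hc, hk⟩ :=
    SimpleGraph.DualPlanar.exists_coloring _ _ rfl (dualPlanar_of_isPlanar hplanar) htf T hT
  have hadj : ∀ x (hx : x ≠ v), H.Adj v x → c ⟨x, hx⟩ ≠ k := fun x hx hvx =>
    hk ⟨x, hx⟩ (Finset.mem_filter.2 ⟨Finset.mem_univ _, hvx⟩)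
  refine ⟨SimpleGraph.Coloring.mk (fun x => if hx : x ≠ v then c ⟨x, hx⟩ else k) ?_⟩
  intro x y hxy
  by_cases hx : x = v
  · subst hx
    rw [dif_neg (not_not.2 rfl), dif_pos hxy.ne']
    exact (hadj y hxy.ne' hxy).symm
  · by_cases hy : y = v
    · subst hy
      rw [dif_pos hx, dif_neg (not_not.2 rfl)]
      exact hadj x hx hxy.symm
    · rw [dif_pos hx, dif_pos hy]
      exact hc ⟨x, hx⟩ ⟨y, hy⟩ hxy
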